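/- Let S ⊆ ℝⁿ (n ≥ 2) be a centrally symmetric convex body of class C²₊ (C² boundary with everywhere strictly positive Gauss curvature). Then there is a nonnegative function Φ with Φ(δ) → 0 as δ → 0 such that for all sufficiently small δ > 0, (1 − (1 + Φ(δ))·G_max·δ^{2/(n+1)})·S ⊆ S_δ ⊆ (1 − (1 − Φ(δ))·G_min·δ^{2/(n+1)})·S. -/

import Mathlib

open MeasureTheory Metric Set Filter
open scoped RealInnerProductSpace Pointwise Topology

noncomputable section

abbrev Euc (n : ℕ) : Type := EuclideanSpace ℝ (Fin n)

/-- A centrally symmetric convex body in `ℝⁿ`. -/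
def IsSymConvexBody {n : ℕ} (S : Set (Euc n)) : Prop :=
  IsCompact S ∧ Convex ℝ S ∧ (interior S).Nonempty ∧ S = -S

/-- The convex floating body `K_δ`: the intersection of all closed halfspaces whose bounding
hyperplane cuts off a set of volume at most `δ·|K|ₙ` from `K`. -/
def floatingBody {n : ℕ} (K : Set (Euc n)) (δ : ℝ) : Set (Euc n) :=
  ⋂ (v : Euc n) (_ : v ≠ 0) (c : ℝ)
    (_ : volume (K ∩ {y | c ≤ ⟪v, y⟫}) ≤ ENNReal.ofReal δ * volume K),
    {y | ⟪v, y⟫ ≤ c}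

/-- The illumination body `K^δ`. -/
def illuminationBody {n : ℕ} (K : Set (Euc n)) (δ : ℝ) : Set (Euc n) :=
  {x | volume (convexHull ℝ (K ∪ {x})) ≤ ENNReal.ofReal (1 + δ) * volume K}

/-- The polar body `K°`. -/
def polarBody {n : ℕ} (K : Set (Euc n)) : Set (Euc n) :=
  {y | ∀ x ∈ K, ⟪x, y⟫ ≤ 1}

/-- The distance `d(C₁, C₂) = inf {a ≥ 1 : a⁻¹ C₁ ⊆ C₂ ⊆ a C₁}`. -/
def bodyDist {n : ℕ} (C₁ C₂ : Set (Euc n)) : ℝ :=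
  sInf {a : ℝ | 1 ≤ a ∧ a⁻¹ • C₁ ⊆ C₂ ∧ C₂ ⊆ a • C₁}

/-- `d_C(δ) = inf_{δ' > 0} d(C_δ, ((C°)^{δ'})°)`. -/
def dualDist {n : ℕ} (C : Set (Euc n)) (δ : ℝ) : ℝ :=
  sInf {r : ℝ | ∃ δ' > (0:ℝ), r = bodyDist (floatingBody C δ)
      (polarBody (illuminationBody (polarBody C) δ'))}

/-- `ν` is an outer unit normal of `S` at `x`. -/
def IsOuterNormalAt {n : ℕ} (S : Set (Euc n)) (x ν : Euc n) : Prop :=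
  ‖ν‖ = 1 ∧ ∀ y ∈ S, ⟪y, ν⟫ ≤ ⟪x, ν⟫

/-- Near `x ∈ ∂S`, the boundary of `S` is the graph of a `C²` function `f` over the tangent
hyperplane at `x` (embedded via a linear isometry `L` orthogonal to the normal `ν`), with
`f 0 = 0` and vanishing derivative at `0`, and `k` is the determinant of the Hessian of `f`
at `0`, i.e. the Gauss curvature of `∂S` at `x`. -/
def IsGaussCurvatureAt {n : ℕ} (S : Set (Euc n)) (x ν : Euc n) (k : ℝ) : Prop :=
  ∃ (L : Euc (n-1) →ₗᵢ[ℝ] Euc n) (f : Euc (n-1) → ℝ) (τ ε : ℝ),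
    0 < τ ∧ 0 < ε ∧
    (∀ v, ⟪L v, ν⟫ = 0) ∧
    ContDiffOn ℝ 2 f (ball 0 τ) ∧
    f 0 = 0 ∧ fderiv ℝ f 0 = 0 ∧
    frontier S ∩ ball x ε
      = {y | ∃ v ∈ ball (0 : Euc (n-1)) τ, y = x + L v - f v • ν} ∩ ball x ε ∧
    k = (Matrix.of fun i j : Fin (n-1) =>
      iteratedFDeriv ℝ 2 f 0 ![EuclideanSpace.single i 1, EuclideanSpace.single j 1]).det

/-- `S` has `C²` boundary, with outer unit normal map `u` and Gauss curvature function `κ`. -/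
def IsC2Body {n : ℕ} (S : Set (Euc n)) (u : Euc n → Euc n) (κ : Euc n → ℝ) : Prop :=
  ∀ x ∈ frontier S, IsOuterNormalAt S x (u x) ∧ IsGaussCurvatureAt S x (u x) (κ x)

/-- The constant `c(K, n) = ((n+1)^{2/(n+1)}/2)·(|K|ₙ/|B₂^{n−1}|_{n−1})^{2/(n+1)}`. -/
def cConst (n : ℕ) (K : Set (Euc n)) : ℝ :=
  ((n + 1 : ℝ) ^ ((2:ℝ)/(n+1)) / 2) *
    ((volume K).toReal / (volume (ball (0 : Euc (n-1)) 1)).toReal) ^ ((2:ℝ)/(n+1))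

/-- The function `G_S(x) = c(S,n)·κ(x)^{1/(n+1)} / ⟨x, u(x)⟩`. -/
def Gfun {n : ℕ} (S : Set (Euc n)) (u : Euc n → Euc n) (κ : Euc n → ℝ) (x : Euc n) : ℝ :=
  cConst n S * (κ x) ^ ((1:ℝ)/(n+1)) / ⟪x, u x⟫

/-- The volume of the paraboloid cap `{(w, z) : ‖w‖² ≤ 2 z ≤ 2}` in `ℝᵈ × ℝ`. -/
def paraboloidConst (d : ℕ) : ℝ :=
  (volume (ball (0 : Euc d) 1)).toReal * 2 ^ ((d : ℝ) / 2) / ((d : ℝ) / 2 + 1)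

theorem paraboloidConst_pos (d : ℕ) : 0 < paraboloidConst d := by
  have : 0 < (volume (ball (0 : Euc d) 1)).toReal :=
    ENNReal.toReal_pos (measure_ball_pos _ _ one_pos).ne' measure_ball_lt_top.ne
  unfold paraboloidConst
  positivity

theorem volume_paraboloid {d : ℕ} (M : Euc d →ₗ[ℝ] Euc d) (hM : LinearMap.det M ≠ 0) {Δ : ℝ}
    (hΔ : 0 ≤ Δ) :
    volume {p : Euc d × ℝ | ‖M p.1‖ ^ 2 ≤ 2 * p.2 ∧ p.2 ≤ Δ}
      = ENNReal.ofReal (paraboloidConst d / |LinearMap.det M| * Δ ^ ((d : ℝ) / 2 + 1)) := by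
  set b := (volume (ball (0 : Euc d) 1)).toReal with hb
  have hMc : Continuous M := M.continuous_of_finiteDimensional
  have hmeas : MeasurableSet {p : Euc d × ℝ | ‖M p.1‖ ^ 2 ≤ 2 * p.2 ∧ p.2 ≤ Δ} := by
    have h1 : Continuous fun p : Euc d × ℝ => ‖M p.1‖ ^ 2 := by fun_prop
    exact ((isClosed_le h1 (continuous_snd.const_mul 2)).inter
      (isClosed_le continuous_snd continuous_const)).measurableSet
  rw [Measure.volume_eq_prod, Measure.prod_apply_symm hmeas]
  have hslice : ∀ z : ℝ, volume ((fun w : Euc d => (w, z)) ⁻¹'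
      {p : Euc d × ℝ | ‖M p.1‖ ^ 2 ≤ 2 * p.2 ∧ p.2 ≤ Δ})
      = (Icc 0 Δ).indicator (fun z => ENNReal.ofReal
        (|LinearMap.det M|⁻¹ * (2 ^ ((d : ℝ) / 2) * b) * z ^ ((d : ℝ) / 2))) z := by
    intro z
    by_cases hz : z ∈ Icc 0 Δ
    · rw [indicator_of_mem hz]
      have : ((fun w : Euc d => (w, z)) ⁻¹' {p : Euc d × ℝ | ‖M p.1‖ ^ 2 ≤ 2 * p.2 ∧ p.2 ≤ Δ})
          = M ⁻¹' closedBall 0 (√(2 * z)) := by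
        ext w
        simp only [mem_preimage, mem_ofPred_eq, mem_closedBall, dist_zero_right, hz.2, and_true]
        rw [Real.le_sqrt (norm_nonneg _) (by linarith [hz.1])]
      rw [this, Measure.addHaar_preimage_linearMap _ hM,
        Measure.addHaar_closedBall _ _ (Real.sqrt_nonneg _),
        ← ENNReal.ofReal_toReal (measure_ball_lt_top (μ := volume) (x := (0 : Euc d)) (r := 1)).ne,
        ← hb, ← ENNReal.ofReal_mul (by positivity), ← ENNReal.ofReal_mul (by positivity)]
      congr 1
      rw [abs_inv, finrank_euclideanSpace_fin, Real.sqrt_eq_rpow, ← Real.rpow_mul_natCast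
        (by linarith [hz.1]), Real.mul_rpow (by norm_num) hz.1]
      rw [show (1 / 2 * (d : ℝ)) = d / 2 by ring]
      ring
    · rw [indicator_of_notMem hz]
      have : ((fun w : Euc d => (w, z)) ⁻¹' {p : Euc d × ℝ | ‖M p.1‖ ^ 2 ≤ 2 * p.2 ∧ p.2 ≤ Δ})
          = ∅ := by
        ext w
        simp only [mem_preimage, mem_ofPred_eq, mem_empty_iff_false, iff_false]
        rintro ⟨h1, h2⟩
        exact hz ⟨by nlinarith [sq_nonneg ‖M w‖], h2⟩
      rw [this, measure_empty]
  simp_rw [hslice]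
  rw [lintegral_indicator measurableSet_Icc, ← ofReal_integral_eq_lintegral_ofReal]
  · congr 1
    rw [integral_Icc_eq_integral_Ioc, ← intervalIntegral.integral_of_le hΔ,
      intervalIntegral.integral_const_mul, integral_rpow (Or.inl (by
        have : (0 : ℝ) ≤ d := Nat.cast_nonneg d
        linarith)), Real.zero_rpow (by positivity)]
    unfold paraboloidConst
    rw [← hb]
    field_simp
    ring
  · apply ContinuousOn.integrableOn_Icc
    apply ContinuousOn.mul continuousOn_const
    exact (Real.continuous_rpow_const (by positivity)).continuousOn
  · filter_upwards [ae_restrict_mem measurableSet_Icc] with z hz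
    have := Real.rpow_nonneg hz.1 ((d : ℝ) / 2)
    positivity

theorem abs_sub_quadratic_le {E : Type*} [NormedAddCommGroup E] [NormedSpace ℝ E] {f : E → ℝ}
    (hf : ContDiffAt ℝ 2 f 0) {ε : ℝ} (hε : 0 < ε) :
    ∃ r > 0, ∀ w₀ ∈ ball (0 : E) r, DifferentiableAt ℝ f w₀ ∧ ∀ w ∈ ball (0 : E) r,
      |f w - f w₀ - fderiv ℝ f w₀ (w - w₀)
        - fderiv ℝ (fderiv ℝ f) 0 (w - w₀) (w - w₀) / 2| ≤ ε * ‖w - w₀‖ ^ 2 := by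
  set A := fderiv ℝ (fderiv ℝ f) 0 with hA
  have hsymm : ∀ a b, A a b = A b a := fun a b =>
    (hf.isSymmSndFDerivAt (by simp [minSmoothness_of_isRCLikeNormedField])) a b
  have h1 : ContDiffAt ℝ 1 (fderiv ℝ f) 0 := hf.fderiv_right (by norm_num)
  have h2 : HasStrictFDerivAt (fderiv ℝ f) A 0 := h1.hasStrictFDerivAt (by norm_num)
  have h3 := (h2.isLittleO.def hε)
  have h4 : ∀ᶠ w in 𝓝 (0 : E), DifferentiableAt ℝ f w :=
    (hf.eventually (by simp)).mono fun w hw => hw.differentiableAt (by norm_num)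
  obtain ⟨r1, hr1, h3⟩ := Metric.eventually_nhds_iff_ball.1 h3
  obtain ⟨r2, hr2, h4⟩ := Metric.eventually_nhds_iff_ball.1 h4
  refine ⟨min r1 r2, lt_min hr1 hr2, fun w₀ hw₀ => ⟨h4 _ (ball_subset_ball (min_le_right _ _) hw₀),
    fun w hw => ?_⟩⟩
  let g : E → ℝ := fun v => f v - f w₀ - fderiv ℝ f w₀ (v - w₀) - A (v - w₀) (v - w₀) / 2
  have hg : ∀ v ∈ segment ℝ w₀ w, HasFDerivWithinAt g
      (fderiv ℝ f v - fderiv ℝ f w₀ - A (v - w₀)) (segment ℝ w₀ w) v := by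
    intro v hv
    have hvb : v ∈ ball (0 : E) (min r1 r2) := (convex_ball _ _).segment_subset hw₀ hw hv
    have hfv := (h4 v (ball_subset_ball (min_le_right _ _) hvb)).hasFDerivAt
    have hsub : HasFDerivAt (fun v : E => v - w₀) (ContinuousLinearMap.id ℝ E) v :=
      (hasFDerivAt_id v).sub_const w₀
    have hAq := ((A.hasFDerivAt.comp v hsub).clm_apply hsub).mul_const (1 / 2 : ℝ)
    have := ((hfv.sub_const (f w₀)).sub ((fderiv ℝ f w₀).hasFDerivAt.comp v hsub)).sub hAq
    refine (HasFDerivAt.congr_fderiv (this.congr_of_eventuallyEq (Eventually.of_forall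
      fun x => ?_)) ?_).hasFDerivWithinAt
    · simp [g]
      ring
    · ext a
      simp [hsymm a]
      ring
  have := Convex.norm_image_sub_le_of_norm_hasFDerivWithin_le hg (C := ε * ‖w - w₀‖) ?_
    (convex_segment w₀ w) (left_mem_segment ℝ w₀ w) (right_mem_segment ℝ w₀ w)
  · simpa [g, pow_two, mul_assoc] using this
  · intro v hv
    have hvb : v ∈ ball (0 : E) (min r1 r2) := (convex_ball _ _).segment_subset hw₀ hw hv
    have h5 := h3 (v, w₀) (by
      rw [← ball_prod_same]
      exact ⟨ball_subset_ball (min_le_left _ _) hvb, ball_subset_ball (min_le_left _ _) hw₀⟩)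
    refine h5.trans ?_
    gcongr
    obtain ⟨θ, hθ, rfl⟩ := (segment_eq_image' ℝ w₀ w ▸ hv)
    simp only [add_sub_cancel_left, norm_smul, Real.norm_eq_abs, abs_of_nonneg hθ.1]
    nlinarith [norm_nonneg (w - w₀), hθ.2]

theorem volume_sheared_paraboloid {d : ℕ} (M : Euc d →ₗ[ℝ] Euc d) (hM : LinearMap.det M ≠ 0)
    (w₀ : Euc d) (z₀ : ℝ) (l : Euc d →L[ℝ] ℝ) {a Δ : ℝ} (ha : 0 < a) (hΔ : 0 ≤ Δ) :
    volume {p : Euc d × ℝ | a * ‖M (p.1 - w₀)‖ ^ 2 ≤ 2 * (p.2 - z₀ - l (p.1 - w₀)) ∧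
        p.2 - z₀ - l (p.1 - w₀) ≤ Δ}
      = ENNReal.ofReal ((√a ^ d)⁻¹ *
          (paraboloidConst d / |LinearMap.det M| * Δ ^ ((d : ℝ) / 2 + 1))) := by
  have hsa : 0 < √a := Real.sqrt_pos.2 ha
  have hdet : LinearMap.det (√a • M) = √a ^ d * LinearMap.det M := by
    rw [LinearMap.det_smul, finrank_euclideanSpace_fin]
  have hdet0 : LinearMap.det (√a • M) ≠ 0 := by
    rw [hdet]
    exact mul_ne_zero (pow_pos hsa d).ne' hM
  have hmp : MeasurePreserving (fun p : Euc d × ℝ => (p.1 - w₀, p.2 - (z₀ + l (p.1 - w₀))))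
      volume volume := by
    rw [Measure.volume_eq_prod]
    refine (measurePreserving_sub_right volume w₀).skew_product
      (g := fun w z => z - (z₀ + l (w - w₀))) ?_ ?_
    · exact Continuous.measurable (by fun_prop)
    · exact Eventually.of_forall fun w => (measurePreserving_sub_right volume _).map_eq
  have hmeas : MeasurableSet {p : Euc d × ℝ | ‖(√a • M) p.1‖ ^ 2 ≤ 2 * p.2 ∧ p.2 ≤ Δ} := by
    have hc : Continuous (√a • M) := LinearMap.continuous_of_finiteDimensional _
    have h1 : Continuous fun p : Euc d × ℝ => ‖(√a • M) p.1‖ ^ 2 :=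
      (hc.comp continuous_fst).norm.pow 2
    exact ((isClosed_le h1 (continuous_snd.const_mul 2)).inter
      (isClosed_le continuous_snd continuous_const)).measurableSet
  have hpre := hmp.measure_preimage hmeas.nullMeasurableSet
  rw [volume_paraboloid _ hdet0 hΔ, hdet, abs_mul, abs_of_pos (pow_pos hsa d)] at hpre
  convert hpre using 2
  · ext p
    simp [norm_smul, mul_pow, Real.sq_sqrt ha.le, abs_of_pos hsa, sub_sub]
  · field_simp

theorem exists_mul_sq_norm_le {d : ℕ} (M : Euc d →ₗ[ℝ] Euc d) (hM : LinearMap.det M ≠ 0) :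
    ∃ m > 0, ∀ w, m * ‖w‖ ^ 2 ≤ ‖M w‖ ^ 2 := by
  have hker : LinearMap.ker M = ⊥ := by
    by_contra h
    exact hM (LinearMap.det_eq_zero_iff_ker_ne_bot.2 h)
  obtain ⟨K, hK, hanti⟩ := M.exists_antilipschitzWith hker
  have hK' : (0 : ℝ) < K := hK
  refine ⟨((K : ℝ) ^ 2)⁻¹, by positivity, fun w => ?_⟩
  have h1 : ‖w‖ ≤ K * ‖M w‖ := by
    simpa using hanti.le_mul_dist w 0
  rw [inv_mul_le_iff₀ (by positivity), ← mul_pow]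
  gcongr

theorem volume_cap_graph {d : ℕ} {T : Set (Euc d × ℝ)} (hT : Convex ℝ T) {f : Euc d → ℝ}
    (hf : ContDiffAt ℝ 2 f 0) (hf0 : f 0 = 0) (hf1 : fderiv ℝ f 0 = 0) {ρ : ℝ} (hρ : 0 < ρ)
    (hTf : ∀ p ∈ ball (0 : Euc d × ℝ) ρ, p ∈ T ↔ f p.1 ≤ p.2)
    {M : Euc d →ₗ[ℝ] Euc d} (hM : LinearMap.det M ≠ 0)
    (hMf : ∀ w, fderiv ℝ (fderiv ℝ f) 0 w w = ‖M w‖ ^ 2) {η : ℝ} (hη : 0 < η) :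
    ∃ r > 0, ∀ w₀ ∈ ball (0 : Euc d) r, ∀ Δ, 0 < Δ → Δ < r →
      ENNReal.ofReal ((1 - η) *
          (paraboloidConst d / |LinearMap.det M| * Δ ^ ((d : ℝ) / 2 + 1)))
        ≤ volume (T ∩ {p | p.2 - f w₀ - fderiv ℝ f w₀ (p.1 - w₀) ≤ Δ}) ∧
      volume (T ∩ {p | p.2 - f w₀ - fderiv ℝ f w₀ (p.1 - w₀) ≤ Δ})
        ≤ ENNReal.ofReal ((1 + η) *
          (paraboloidConst d / |LinearMap.det M| * Δ ^ ((d : ℝ) / 2 + 1))) := by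
  obtain ⟨ε, hε0, hε1, hεl, hεu⟩ : ∃ ε : ℝ, 0 < ε ∧ ε ≤ 1 / 2 ∧
      1 - η ≤ (√(1 + ε) ^ d)⁻¹ ∧ (√(1 - ε) ^ d)⁻¹ ≤ 1 + η := by
    have h1 : ContinuousAt (fun ε : ℝ => (√(1 + ε) ^ d)⁻¹) 0 :=
      ContinuousAt.inv₀ (by fun_prop) (by simp)
    have h2 : ContinuousAt (fun ε : ℝ => (√(1 - ε) ^ d)⁻¹) 0 :=
      ContinuousAt.inv₀ (by fun_prop) (by simp)
    have e1 := h1.tendsto.eventually_const_lt (u := 1 - η) (by simpa using hη)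
    have e2 := h2.tendsto.eventually_lt_const (u := 1 + η) (by simpa using hη)
    have e3 : ∀ᶠ ε : ℝ in 𝓝 0, ε < 1 / 2 := gt_mem_nhds (by norm_num)
    obtain ⟨ε, ⟨⟨h1, h2⟩, h3⟩, h4⟩ :=
      ((((e1.and e2).and e3).filter_mono nhdsWithin_le_nhds).and
        (self_mem_nhdsWithin (s := Ioi (0 : ℝ)))).exists
    exact ⟨ε, h4, h3.le, h1.le, h2.le⟩
  obtain ⟨m, hm, hMm⟩ := exists_mul_sq_norm_le M hM
  obtain ⟨r₁, hr₁, hquad⟩ := abs_sub_quadratic_le hf (ε := ε * m / 2) (by positivity)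
  set R := min r₁ ρ with hRdef
  have hR : 0 < R := lt_min hr₁ hρ
  have hfc : ContinuousAt f 0 := hf.continuousAt
  have hfdc : ContinuousAt (fderiv ℝ f) 0 :=
    (hf.fderiv_right (m := 1) (by norm_num)).continuousAt
  have ev1 : ∀ᶠ w in 𝓝 (0 : Euc d), |f w| < R / 4 := 
    hfc.abs.tendsto.eventually_lt_const (by simp [hf0, hR])
  have ev2 : ∀ᶠ w in 𝓝 (0 : Euc d), ‖fderiv ℝ f w‖ < 1 / 2 := 
    hfdc.norm.tendsto.eventually_lt_const (by simp [hf1])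
  obtain ⟨r₂, hr₂, hev⟩ := Metric.eventually_nhds_iff_ball.1 (ev1.and ev2)
  refine ⟨min (min r₂ (R / 8)) (m * R ^ 2 / 64), by positivity, fun w₀ hw₀ Δ hΔ0 hΔ => ?_⟩
  have hΔ1 : Δ < R / 8 := hΔ.trans_le ((min_le_left _ _).trans (min_le_right _ _))
  have hΔ2 : Δ < m * R ^ 2 / 64 := hΔ.trans_le (min_le_right _ _)
  have hw₀2 : w₀ ∈ ball (0 : Euc d) r₂ :=
    ball_subset_ball ((min_le_left _ _).trans (min_le_left _ _)) hw₀
  have hw₀n : ‖w₀‖ < R / 8 := by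
    simpa using ball_subset_ball ((min_le_left _ _).trans (min_le_right _ _)) hw₀
  obtain ⟨hfw₀, hdw₀⟩ := hev w₀ hw₀2
  set l := fderiv ℝ f w₀ with hl
  set z₀ := f w₀ with hz₀
  have hw₀r : w₀ ∈ ball (0 : Euc d) r₁ := by
    rw [mem_ball_zero_iff]
    linarith [min_le_left r₁ ρ]
  have hbox : ∀ p : Euc d × ℝ, ‖p - (w₀, z₀)‖ ≤ R / 4 →
      p ∈ ball (0 : Euc d × ℝ) ρ ∧ p.1 ∈ ball (0 : Euc d) r₁ := by
    intro p hp
    have hz : ‖((w₀, z₀) : Euc d × ℝ)‖ ≤ R / 4 := by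
      rw [Prod.norm_def]
      exact max_le (by simp; linarith) (by simp; linarith)
    have h1 : ‖p‖ < R := by
      have := norm_add_le (p - (w₀, z₀)) (w₀, z₀)
      rw [sub_add_cancel] at this
      linarith
    exact ⟨by simpa using h1.trans_le (min_le_right _ _),
      by simpa using (norm_fst_le p).trans_lt (h1.trans_le (min_le_left _ _))⟩
  have hquad' : ∀ w ∈ ball (0 : Euc d) r₁,
      (1 - ε) * ‖M (w - w₀)‖ ^ 2 ≤ 2 * (f w - z₀ - l (w - w₀)) ∧
      2 * (f w - z₀ - l (w - w₀)) ≤ (1 + ε) * ‖M (w - w₀)‖ ^ 2 := by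
    intro w hw
    have h1 := abs_le.1 ((hquad w₀ hw₀r).2 w hw)
    rw [hMf] at h1
    have h2 := mul_le_mul_of_nonneg_left (hMm (w - w₀)) hε0.le
    constructor <;> nlinarith [h1.1, h1.2]
  have hsmall : ∀ p : Euc d × ℝ, 1 / 2 * ‖M (p.1 - w₀)‖ ^ 2 ≤ 2 * (p.2 - z₀ - l (p.1 - w₀)) →
      p.2 - z₀ - l (p.1 - w₀) ≤ Δ → ‖p - (w₀, z₀)‖ < R / 4 := by
    intro p h1 h2
    have h3 := hMm (p.1 - w₀)
    have h4 : ‖p.1 - w₀‖ < R / 4 := by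
      apply lt_of_pow_lt_pow_left₀ 2 (by positivity)
      have : m * ‖p.1 - w₀‖ ^ 2 < m * (R / 4) ^ 2 := by nlinarith
      exact lt_of_mul_lt_mul_left this hm.le
    have h5 : |l (p.1 - w₀)| ≤ 1 / 2 * ‖p.1 - w₀‖ :=
      (l.le_opNorm _).trans (by gcongr)
    have h6 := abs_le.1 h5
    have h7 := sq_nonneg ‖M (p.1 - w₀)‖
    rw [Prod.norm_def]
    refine max_lt h4 ?_
    simp only [Prod.snd_sub, Real.norm_eq_abs, abs_lt]
    constructor <;> linarith
  have hk : 0 ≤ paraboloidConst d / |LinearMap.det M| * Δ ^ ((d : ℝ) / 2 + 1) := by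
    have := paraboloidConst_pos d
    positivity
  constructor
  · refine (ENNReal.ofReal_le_ofReal (mul_le_mul_of_nonneg_right hεl hk)).trans ?_
    rw [← volume_sheared_paraboloid M hM w₀ z₀ l (by linarith) hΔ0.le]
    refine measure_mono fun p hp => ⟨?_, hp.2⟩
    have hp1 := hp.1
    have hn := hsmall p (by nlinarith [sq_nonneg ‖M (p.1 - w₀)‖]) hp.2
    obtain ⟨hb1, hb2⟩ := hbox p hn.le
    rw [hTf p hb1]
    linarith [(hquad' p.1 hb2).2]
  · refine le_trans ?_ (ENNReal.ofReal_le_ofReal (mul_le_mul_of_nonneg_right hεu hk))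
    rw [← volume_sheared_paraboloid M hM w₀ z₀ l (by linarith) hΔ0.le]
    refine measure_mono fun p hp => ?_
    have hnear : ∀ q ∈ T, q.2 - z₀ - l (q.1 - w₀) ≤ Δ → ‖q - (w₀, z₀)‖ ≤ R / 4 →
        (1 - ε) * ‖M (q.1 - w₀)‖ ^ 2 ≤ 2 * (q.2 - z₀ - l (q.1 - w₀)) := by
      intro q hq hq2 hqn
      obtain ⟨hb1, hb2⟩ := hbox q hqn
      linarith [(hquad' q.1 hb2).1, (hTf q hb1).1 hq]
    have hnear' : ∀ q ∈ T, q.2 - z₀ - l (q.1 - w₀) ≤ Δ → ‖q - (w₀, z₀)‖ ≤ R / 4 →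
        ‖q - (w₀, z₀)‖ < R / 4 := by
      intro q hq hq2 hqn
      exact hsmall q (by nlinarith [sq_nonneg ‖M (q.1 - w₀)‖, hnear q hq hq2 hqn]) hq2
    refine ⟨hnear p hp.1 hp.2 ?_, hp.2⟩
    by_contra! hlt
    have hp0 : ((w₀, z₀) : Euc d × ℝ) ∈ T := (hTf _ (hbox _ (by simp; positivity)).1).2 le_rfl
    set θ := R / 4 / ‖p - (w₀, z₀)‖ with hθ
    have hnpos : 0 < ‖p - (w₀, z₀)‖ := by linarith
    have hθ0 : 0 < θ := by positivity
    have hθ1 : θ ≤ 1 := (div_le_one hnpos).2 hlt.le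
    have hq : (w₀, z₀) + θ • (p - (w₀, z₀)) ∈ T :=
      hT.add_smul_sub_mem hp0 hp.1 ⟨hθ0.le, hθ1⟩
    have hqn : ‖(w₀, z₀) + θ • (p - (w₀, z₀)) - (w₀, z₀)‖ = R / 4 := by
      rw [add_sub_cancel_left, norm_smul, Real.norm_of_nonneg hθ0.le, hθ,
        div_mul_cancel₀ _ hnpos.ne']
    refine (hnear' _ hq ?_ hqn.le).ne hqn
    have h2 : p.2 - z₀ - l (p.1 - w₀) ≤ Δ := hp.2
    have : ((w₀, z₀) + θ • (p - (w₀, z₀))).2 - z₀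
        - l (((w₀, z₀) + θ • (p - (w₀, z₀))).1 - w₀) = θ * (p.2 - z₀ - l (p.1 - w₀)) := by
      simp [-map_sub]
      ring
    rw [this]
    calc θ * (p.2 - z₀ - l (p.1 - w₀)) ≤ θ * Δ := by gcongr
      _ ≤ Δ := mul_le_of_le_one_left hΔ0.le hθ1

theorem fderiv_fderiv_nonneg_of_isLocalMin {E : Type*} [NormedAddCommGroup E] [NormedSpace ℝ E]
    {f : E → ℝ} (hf : ContDiffAt ℝ 2 f 0) (hmin : IsLocalMin f 0) (w : E) :
    0 ≤ fderiv ℝ (fderiv ℝ f) 0 w w := by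
  set A := fderiv ℝ (fderiv ℝ f) 0 with hA
  have key : ∀ ε > 0, 0 ≤ A w w + 2 * (ε * ‖w‖ ^ 2) := by
    intro ε hε
    obtain ⟨r, hr, hq⟩ := abs_sub_quadratic_le hf hε
    have ht : Tendsto (fun t : ℝ => t • w) (𝓝[>] 0) (𝓝 0) := by
      have : Continuous fun t : ℝ => t • w := by fun_prop
      simpa using (this.tendsto 0).mono_left (nhdsWithin_le_nhds (s := Ioi 0))
    have h1 := ht.eventually (ball_mem_nhds (0 : E) hr)
    have h2 := ht.eventually hmin
    obtain ⟨t, ⟨h1, h2⟩, h3⟩ := ((h1.and h2).and (self_mem_nhdsWithin (s := Ioi (0 : ℝ)))).exists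
    have h4 := (abs_le.1 ((hq 0 (mem_ball_self hr)).2 _ h1)).2
    rw [hmin.fderiv_eq_zero, sub_zero, ← hA] at h4
    simp only [map_smul, smul_apply, zero_apply,
      smul_eq_mul, norm_smul, mul_pow, Real.norm_eq_abs, sq_abs] at h4
    have ht0 : (0 : ℝ) < t := h3
    have h5 : 0 ≤ t ^ 2 * (A w w + 2 * (ε * ‖w‖ ^ 2)) := by
      nlinarith
    exact nonneg_of_mul_nonneg_right h5 (by positivity)
  have hc : Continuous fun ε : ℝ => A w w + 2 * (ε * ‖w‖ ^ 2) := by fun_prop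
  have := ge_of_tendsto ((hc.tendsto 0).mono_left (nhdsWithin_le_nhds (s := Ioi 0)))
    (eventually_nhdsWithin_of_forall fun ε hε => key ε hε)
  simpa using this

open scoped MatrixOrder Matrix.Norms.L2Operator in
theorem exists_sqrt_of_bilin_nonneg {d : ℕ} (A : Euc d →L[ℝ] Euc d →L[ℝ] ℝ)
    (hsymm : ∀ a b, A a b = A b a) (hpos : ∀ w, 0 ≤ A w w) :
    ∃ M : Euc d →ₗ[ℝ] Euc d, (∀ w, A w w = ‖M w‖ ^ 2) ∧
      LinearMap.det M ^ 2 = (Matrix.of fun i j : Fin d =>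
        A (EuclideanSpace.single i 1) (EuclideanSpace.single j 1)).det := by
  set H : Matrix (Fin d) (Fin d) ℝ := Matrix.of fun i j : Fin d =>
    A (EuclideanSpace.single i 1) (EuclideanSpace.single j 1) with hH
  have hquad : ∀ w : Euc d, A w w = w.ofLp ⬝ᵥ H.mulVec w.ofLp := by
    intro w
    have hw : w = ∑ i, w i • EuclideanSpace.single i (1 : ℝ) := by
      simpa using ((EuclideanSpace.basisFun (Fin d) ℝ).sum_repr w).symm
    conv_lhs => rw [hw]
    simp only [map_sum, map_smul, sum_apply, smul_apply,
      smul_eq_mul, dotProduct, Matrix.mulVec, hH, Matrix.of_apply, Finset.mul_sum]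
    rw [Finset.sum_comm]
    exact Finset.sum_congr rfl fun i _ => Finset.sum_congr rfl fun j _ => by ring
  have hpsd : H.PosSemidef := by
    refine .of_dotProduct_mulVec_nonneg ?_ fun x => ?_
    · ext i j
      simp [hH, hsymm]
    · have := hpos (WithLp.toLp 2 x)
      rw [hquad] at this
      simpa using this
  obtain ⟨B, hB⟩ := CStarAlgebra.nonneg_iff_eq_star_mul_self.mp hpsd.nonneg
  refine ⟨Matrix.toEuclideanLin B, fun w => ?_, ?_⟩
  · rw [hquad, hB, ← real_inner_self_eq_norm_sq, EuclideanSpace.inner_eq_star_dotProduct]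
    simp [Matrix.toLpLin_apply, ← Matrix.mulVec_mulVec, Matrix.star_eq_conjTranspose,
      Matrix.dotProduct_mulVec, Matrix.vecMul_transpose]
  · rw [hB, Matrix.det_mul, Matrix.star_eq_conjTranspose, Matrix.det_conjTranspose]
    simp [Matrix.toEuclideanLin, sq]

theorem exists_sqrt_hessian {d : ℕ} {f : Euc d → ℝ} (hf : ContDiffAt ℝ 2 f 0)
    (hmin : IsLocalMin f 0) :
    ∃ M : Euc d →ₗ[ℝ] Euc d, (∀ w, fderiv ℝ (fderiv ℝ f) 0 w w = ‖M w‖ ^ 2) ∧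
      LinearMap.det M ^ 2 = (Matrix.of fun i j : Fin d =>
        iteratedFDeriv ℝ 2 f 0 ![EuclideanSpace.single i 1, EuclideanSpace.single j 1]).det := by
  obtain ⟨M, h1, h2⟩ := exists_sqrt_of_bilin_nonneg (fderiv ℝ (fderiv ℝ f) 0)
    (fun a b => (hf.isSymmSndFDerivAt (by simp [minSmoothness_of_isRCLikeNormedField])) a b)
    (fderiv_fderiv_nonneg_of_isLocalMin hf hmin)
  refine ⟨M, h1, ?_⟩
  simpa [iteratedFDeriv_two_apply] using h2

theorem Convex.mem_iff_le_near_graph {E : Type*} [NormedAddCommGroup E] [NormedSpace ℝ E]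
    {T : Set (E × ℝ)} (hT : Convex ℝ T) (hcl : IsClosed T) (hint : (interior T).Nonempty)
    (hpos : ∀ p ∈ T, 0 ≤ p.2) {f : E → ℝ} {ε : ℝ} (hε : 0 < ε)
    (hgraph : ∀ᶠ w in 𝓝 0, (w, f w) ∈ T)
    (hfront : ∀ p ∈ frontier T, ‖p‖ < ε → p.2 = f p.1) :
    ∃ ρ > 0, ∀ p ∈ ball (0 : E × ℝ) ρ, p ∈ T ↔ f p.1 ≤ p.2 := by
  have hvert : ∀ p ∈ interior T, ∀ᶠ s in 𝓝 (0 : ℝ), (p.1, p.2 + s) ∈ T := by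
    intro p hp
    have hc : Continuous fun s : ℝ => (p.1, p.2 + s) := by fun_prop
    have := hc.tendsto 0
    rw [add_zero] at this
    exact this.eventually (mem_interior_iff_mem_nhds.1 hp)
  obtain ⟨c, hc⟩ := hint
  obtain ⟨δ, hδT, hδ⟩ : ∃ δ : ℝ, (c.1, c.2 + δ) ∈ T ∧ 0 < δ :=
    (((hvert c hc).filter_mono nhdsWithin_le_nhds).and
      (self_mem_nhdsWithin (s := Ioi (0 : ℝ)))).exists
  have hcont : ContinuousAt (fun q : E × ℝ => (1 - q.2)⁻¹ • (q.1 - q.2 • c.1)) (0, 0) := by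
    refine ContinuousAt.smul (ContinuousAt.inv₀ (by fun_prop) (by simp)) (by fun_prop)
  have hev : ∀ᶠ q : E × ℝ in 𝓝 (0, 0), ((1 - q.2)⁻¹ • (q.1 - q.2 • c.1),
      f ((1 - q.2)⁻¹ • (q.1 - q.2 • c.1))) ∈ T := by
    have h1 := hcont.tendsto
    simp only [zero_smul, sub_zero, smul_zero] at h1
    exact h1.eventually hgraph
  obtain ⟨r, hr, hrT⟩ := Metric.eventually_nhds_iff_ball.1 hev
  obtain ⟨r₂, hr₂, hgr⟩ := Metric.eventually_nhds_iff_ball.1 hgraph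
  obtain ⟨t, ht0, ht1⟩ := exists_between (show (0 : ℝ) < min r 1 by positivity)
  have htr : t < r := ht1.trans_le (min_le_left _ _)
  have ht1 : t < 1 := ht1.trans_le (min_le_right _ _)
  have hseg : ∀ w : E, ‖w‖ < r → ∃ a : ℝ, (w, a) ∈ T ∧ (w, a + t * δ) ∈ T := by
    intro w hw
    have h1 := hrT (w, t) (by
      rw [← ball_prod_same]
      exact ⟨by simpa using hw, by simpa [abs_of_pos ht0] using htr⟩)
    simp only at h1
    set w' := (1 - t)⁻¹ • (w - t • c.1) with hw'
    have hww : (1 - t) • w' + t • c.1 = w := by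
      rw [hw', smul_inv_smul₀ (by linarith), sub_add_cancel]
    refine ⟨(1 - t) * f w' + t * c.2, ?_, ?_⟩
    · have := hT h1 (interior_subset hc) (by linarith : 0 ≤ 1 - t) ht0.le (by ring)
      rw [← hww]
      convert this using 1
      exact Prod.ext (by simp) (by simp)
    · have := hT h1 hδT (by linarith : 0 ≤ 1 - t) ht0.le (by ring)
      rw [← hww]
      convert this using 1
      exact Prod.ext (by simp) (by simp; ring)
  have hslice : ∀ w : E, IsClosed {s : ℝ | (w, s) ∈ T} := fun w =>
    hcl.preimage (by fun_prop : Continuous fun s : ℝ => (w, s))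
  have hlow : ∀ p ∈ T, ‖p‖ < ε → f p.1 ≤ p.2 := by
    rintro ⟨w, z⟩ hp hpn
    have hbdd : BddBelow {s : ℝ | (w, s) ∈ T} := ⟨0, fun s hs => hpos _ hs⟩
    have hmem : (w, sInf {s : ℝ | (w, s) ∈ T}) ∈ T := (hslice w).csInf_mem ⟨z, hp⟩ hbdd
    have hle : sInf {s : ℝ | (w, s) ∈ T} ≤ z := csInf_le hbdd hp
    have h0 := hpos _ hmem
    rw [Prod.norm_def, max_lt_iff] at hpn
    have hz0 := hpos _ hp
    simp only [Real.norm_eq_abs] at hpn h0 hz0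
    rw [abs_of_nonneg hz0] at hpn
    have heq : sInf {s : ℝ | (w, s) ∈ T} = f w := by
      refine hfront (w, sInf {s : ℝ | (w, s) ∈ T}) ?_ ?_
      · refine ⟨subset_closure hmem, fun hin => ?_⟩
        obtain ⟨s, hs, hs0⟩ := (((hvert _ hin).filter_mono nhdsWithin_le_nhds).and
          (self_mem_nhdsWithin (s := Iio (0 : ℝ)))).exists
        have := csInf_le hbdd hs
        simp only at this hs0
        linarith
      · rw [Prod.norm_def, max_lt_iff]
        refine ⟨hpn.1, ?_⟩
        simp only [Real.norm_eq_abs]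
        rw [abs_of_nonneg h0]
        linarith
    exact heq ▸ hle
  refine ⟨min (min r r₂) ε, by positivity, ?_⟩
  rintro ⟨w, z⟩ hp
  rw [mem_ball_zero_iff, lt_min_iff, lt_min_iff] at hp
  refine ⟨fun h => hlow _ h hp.2, fun hfz => ?_⟩
  by_contra hnot
  simp only at hfz
  have hwr : ‖w‖ < r := (norm_fst_le (w, z)).trans_lt hp.1.1
  have hwr₂ : ‖w‖ < r₂ := (norm_fst_le (w, z)).trans_lt hp.1.2
  have hfw : (w, f w) ∈ T := hgr w (by simpa using hwr₂)
  have hf0 : 0 ≤ f w := hpos _ hfw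
  have hpε := hp.2
  rw [Prod.norm_def, max_lt_iff] at hpε
  simp only [Real.norm_eq_abs] at hpε
  rw [abs_of_nonneg (hf0.trans hfz)] at hpε
  have hup : ∀ s, (w, s) ∈ T → s < z := by
    intro s hs
    by_contra! hzs
    apply hnot
    have hoc : OrdConnected {s : ℝ | (w, s) ∈ T} := by
      apply Convex.ordConnected
      intro a ha b hb α β hα hβ hαβ
      have := hT ha hb hα hβ hαβ
      simpa [← add_smul, hαβ] using this
    exact hoc.out hfw hs ⟨hfz, hzs⟩
  have hbdd : BddAbove {s : ℝ | (w, s) ∈ T} := ⟨z, fun s hs => (hup s hs).le⟩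
  have hmem : (w, sSup {s : ℝ | (w, s) ∈ T}) ∈ T := (hslice w).csSup_mem ⟨_, hfw⟩ hbdd
  have hsup : sSup {s : ℝ | (w, s) ∈ T} = f w := by
    refine hfront _ ⟨subset_closure hmem, fun hin => ?_⟩ ?_
    · obtain ⟨s, hs, hs0⟩ := (((hvert _ hin).filter_mono nhdsWithin_le_nhds).and
        (self_mem_nhdsWithin (s := Ioi (0 : ℝ)))).exists
      have := le_csSup hbdd hs
      linarith
    · rw [Prod.norm_def, max_lt_iff]
      refine ⟨hpε.1, ?_⟩
      simp only [Real.norm_eq_abs]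
      rw [abs_of_nonneg (hpos _ hmem)]
      exact (hup _ hmem).trans hpε.2
  obtain ⟨a, ha, ha'⟩ := hseg w hwr
  have h1 : a + t * δ ≤ f w := hsup ▸ le_csSup hbdd ha'
  have h2 : f w ≤ a := by
    refine hlow _ ha ?_
    rw [Prod.norm_def, max_lt_iff]
    refine ⟨hpε.1, ?_⟩
    simp only [Real.norm_eq_abs]
    rw [abs_of_nonneg (hpos _ ha)]
    exact (hup _ ha).trans hpε.2
  nlinarith [mul_pos ht0 hδ]

theorem exists_graph_coordinates {n : ℕ} (hn : 1 ≤ n) (L : Euc (n - 1) →ₗᵢ[ℝ] Euc n) {ν : Euc n}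
    (hν : ‖ν‖ = 1) (hL : ∀ v, ⟪L v, ν⟫ = 0) :
    ∃ Λ : (Euc (n - 1) × ℝ) ≃L[ℝ] Euc n, (∀ p, Λ p = L p.1 - p.2 • ν) ∧
      MeasurePreserving Λ := by
  let Λ₀ : WithLp 2 (Euc (n - 1) × ℝ) →ₗᵢ[ℝ] Euc n :=
    { toFun := fun p => L p.fst - p.snd • ν
      map_add' := fun p q => by
        simp only [WithLp.add_fst, WithLp.add_snd, map_add, add_smul]
        abel
      map_smul' := fun c p => by
        simp [smul_sub, mul_smul]
      norm_map' := fun p => by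
        rw [← sq_eq_sq₀ (norm_nonneg _) (norm_nonneg _), WithLp.prod_norm_sq_eq_of_L2]
        simp only [LinearMap.coe_mk, AddHom.coe_mk]
        rw [norm_sub_sq_real, inner_smul_right, hL, L.norm_map, norm_smul, hν]
        simp }
  have hfin : Module.finrank ℝ (WithLp 2 (Euc (n - 1) × ℝ)) = Module.finrank ℝ (Euc n) := by
    rw [(WithLp.linearEquiv 2 ℝ (Euc (n - 1) × ℝ)).finrank_eq, Module.finrank_prod,
      finrank_euclideanSpace_fin, finrank_euclideanSpace_fin, Module.finrank_self]
    omega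
  let Λ₁ := Λ₀.toLinearIsometryEquiv hfin
  refine ⟨((WithLp.linearEquiv 2 ℝ (Euc (n - 1) × ℝ)).symm.trans
    Λ₁.toLinearEquiv).toContinuousLinearEquiv, fun p => rfl, ?_⟩
  exact Λ₁.measurePreserving.comp (WithLp.volume_preserving_toLp _ _)

theorem normal_near_graph {d n : ℕ} (L : Euc d →ₗᵢ[ℝ] Euc n) {ν : Euc n}
    (hν : ‖ν‖ = 1) (hL : ∀ v, ⟪L v, ν⟫ = 0) (Λ : (Euc d × ℝ) ≃L[ℝ] Euc n)
    (hΛ : ∀ p, Λ p = L p.1 - p.2 • ν) {T : Set (Euc d × ℝ)} {f : Euc d → ℝ} {ρ : ℝ}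
    (hTf : ∀ p ∈ ball (0 : Euc d × ℝ) ρ, p ∈ T ↔ f p.1 ≤ p.2) {w₀ : Euc d}
    (hw₀ : (w₀, f w₀) ∈ ball (0 : Euc d × ℝ) ρ) (hd : DifferentiableAt ℝ f w₀) {v : Euc n}
    (hv : ‖v‖ = 1) (hvT : ∀ p ∈ T, ⟪Λ p - Λ (w₀, f w₀), v⟫ ≤ 0) :
    0 < ⟪ν, v⟫ ∧ 1 ≤ ⟪ν, v⟫ ^ 2 * (1 + ‖fderiv ℝ f w₀‖ ^ 2) ∧
      ∀ p, ⟪Λ p, v⟫ = -(⟪ν, v⟫ * (p.2 - fderiv ℝ f w₀ p.1)) := by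
  set α := ⟪ν, v⟫ with hα
  have hnhds : ball (0 : Euc d × ℝ) ρ ∈ 𝓝 (w₀, f w₀) := isOpen_ball.mem_nhds hw₀
  let l : Euc d →L[ℝ] ℝ := (innerSL ℝ v).comp L.toContinuousLinearMap
  have hl : ∀ w, l w = ⟪L w, v⟫ := fun w => by simp [l, real_inner_comm]
  have hmax : IsLocalMax (fun w => l w - f w * α) w₀ := by
    have hc : ContinuousAt (fun w => (w, f w)) w₀ := continuousAt_id.prodMk hd.continuousAt
    filter_upwards [hc.eventually hnhds] with w hw
    have h1 := hvT _ ((hTf _ hw).2 le_rfl)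
    rw [hΛ, hΛ, inner_sub_left, inner_sub_left, inner_sub_left, inner_smul_left,
      inner_smul_left] at h1
    simp only [hl]
    simp only [conj_trivial] at h1
    linarith
  have hder : HasFDerivAt (fun w => l w - f w * α) (l - α • fderiv ℝ f w₀) w₀ :=
    l.hasFDerivAt.sub (hd.hasFDerivAt.mul_const α)
  have hzero := hmax.hasFDerivAt_eq_zero hder
  have hLv : ∀ a, ⟪L a, v⟫ = α * fderiv ℝ f w₀ a := by
    intro a
    have := DFunLike.congr_fun hzero a
    rw [← hl]
    simp only [sub_apply, smul_apply, zero_apply, smul_eq_mul] at this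
    linarith
  have hα0 : 0 ≤ α := by
    have hc : Continuous fun s : ℝ => (w₀, f w₀ + s) := by fun_prop
    have h0 := hc.tendsto 0
    rw [add_zero] at h0
    obtain ⟨s, hs, hs0⟩ := (((h0.eventually hnhds).filter_mono nhdsWithin_le_nhds).and
      (self_mem_nhdsWithin (s := Ioi (0 : ℝ)))).exists
    have hs0 : 0 < s := hs0
    have h1 := hvT _ ((hTf _ hs).2 (by simpa using hs0.le))
    rw [hΛ, hΛ, inner_sub_left, inner_sub_left, inner_sub_left, inner_smul_left,
      inner_smul_left] at h1
    simp only [conj_trivial, ← hα] at h1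
    nlinarith
  have hnorm : 1 ≤ α ^ 2 * (1 + ‖fderiv ℝ f w₀‖ ^ 2) := by
    obtain ⟨⟨b, c⟩, hp⟩ := Λ.surjective v
    rw [hΛ] at hp
    simp only at hp
    have hc : α = -c := by
      rw [hα, ← hp, inner_sub_right, real_inner_comm, hL, inner_smul_right,
        real_inner_self_eq_norm_sq, hν]
      ring
    have hb : ⟪L b, v⟫ = ‖b‖ ^ 2 := by
      rw [← hp, inner_sub_right, inner_smul_right, hL, real_inner_self_eq_norm_sq, L.norm_map]
      ring
    have hvv : ‖b‖ ^ 2 + c ^ 2 = 1 := by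
      have : ⟪v, v⟫ = 1 := by rw [real_inner_self_eq_norm_sq, hv]; norm_num
      nth_rewrite 1 [← hp] at this
      rw [inner_sub_left, hb, inner_smul_left, ← hα, hc] at this
      simp only [conj_trivial] at this
      linarith
    have h1 : ‖b‖ ^ 2 ≤ α * (‖fderiv ℝ f w₀‖ * ‖b‖) := by
      rw [← hb, hLv]
      exact mul_le_mul_of_nonneg_left ((le_abs_self _).trans ((fderiv ℝ f w₀).le_opNorm b)) hα0
    have h2 : ‖b‖ ≤ α * ‖fderiv ℝ f w₀‖ := by
      rcases (norm_nonneg b).eq_or_lt with h | h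
      · rw [← h]
        positivity
      · nlinarith
    have h3 : ‖b‖ ^ 2 ≤ (α * ‖fderiv ℝ f w₀‖) ^ 2 := by gcongr
    have : α ^ 2 = c ^ 2 := by rw [hc]; ring
    nlinarith
  refine ⟨lt_of_le_of_ne hα0 fun h => ?_, hnorm, fun p => ?_⟩
  · rw [← h] at hnorm
    norm_num at hnorm
  · rw [hΛ, inner_sub_left, inner_smul_left, hLv]
    simp only [conj_trivial, ← hα]
    ring

set_option maxHeartbeats 800000 in
theorem volume_cap_near {n : ℕ} (hn : 2 ≤ n) {S : Set (Euc n)} (hS : IsSymConvexBody S)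
    {x ν : Euc n} {k : ℝ} (hν : IsOuterNormalAt S x ν)
    (hk : IsGaussCurvatureAt S x ν k) (hk0 : 0 < k) {η : ℝ} (hη : 0 < η) (hη1 : η < 1) :
    ∃ r > 0, ∀ y ∈ frontier S, dist y x < r → ∀ v, IsOuterNormalAt S y v →
      |⟪y, v⟫ - ⟪x, ν⟫| < η ∧ ∀ Δ, 0 < Δ → Δ < r →
        ENNReal.ofReal ((1 - η) *
            (paraboloidConst (n - 1) / √k * Δ ^ (((n - 1 : ℕ) : ℝ) / 2 + 1)))
          ≤ volume (S ∩ {q | ⟪y, v⟫ - Δ ≤ ⟪v, q⟫}) ∧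
        volume (S ∩ {q | ⟪y, v⟫ - Δ ≤ ⟪v, q⟫})
          ≤ ENNReal.ofReal ((1 + η) *
            (paraboloidConst (n - 1) / √k * Δ ^ (((n - 1 : ℕ) : ℝ) / 2 + 1))) := by
  obtain ⟨hcomp, hconv, hint, -⟩ := hS
  obtain ⟨hν1, hνS⟩ := hν
  obtain ⟨L, f, τ, ε, hτ, hε, hL, hfC, hf0, hf1, hfr, hkdet⟩ := hk
  obtain ⟨Λ, hΛ, hΛmp⟩ := exists_graph_coordinates (by omega) L hν1 hL
  have hfC : ContDiffAt ℝ 2 f 0 := hfC.contDiffAt (ball_mem_nhds _ hτ)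
  have hfc : ContinuousAt f 0 := hfC.continuousAt
  let h : (Euc (n - 1) × ℝ) ≃ₜ Euc n := Λ.toHomeomorph.trans (Homeomorph.addLeft x)
  have hh : ∀ p, h p = x + Λ p := fun p => rfl
  set T : Set (Euc (n - 1) × ℝ) := h ⁻¹' S with hTdef
  have hTconv : Convex ℝ T :=
    (hconv.translate_preimage_right x).linear_preimage Λ.toLinearEquiv.toLinearMap
  have hTcl : IsClosed T := hcomp.isClosed.preimage h.continuous
  have hTint : (interior T).Nonempty := by
    rw [hTdef, ← h.preimage_interior]
    exact hint.preimage h.surjective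
  have hTpos : ∀ p ∈ T, 0 ≤ p.2 := by
    intro p hp
    have := hνS _ hp
    rw [hh, hΛ, inner_add_left, inner_sub_left, hL, inner_smul_left,
      real_inner_self_eq_norm_sq, hν1] at this
    simp only [conj_trivial] at this
    linarith
  have hgc : ContinuousAt (fun w => (w, f w)) 0 := continuousAt_id.prodMk hfc
  have hgt : Tendsto (fun w => (w, f w)) (𝓝 0) (𝓝 (0 : Euc (n - 1) × ℝ)) := by
    have := hgc.tendsto
    rwa [hf0] at this
  have hht : Tendsto h (𝓝 0) (𝓝 x) := by
    have := h.continuous.tendsto 0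
    rwa [hh, map_zero, add_zero] at this
  have hgraph : ∀ᶠ w in 𝓝 (0 : Euc (n - 1)), (w, f w) ∈ T := by
    filter_upwards [ball_mem_nhds _ hτ, (hht.comp hgt).eventually (ball_mem_nhds x hε)]
      with w hw1 hw2
    have h1 : h (w, f w) ∈ frontier S ∩ ball x ε := by
      rw [hfr]
      refine ⟨⟨w, hw1, ?_⟩, hw2⟩
      rw [hh, hΛ]
      exact (add_sub_assoc _ _ _).symm
    exact hcomp.isClosed.frontier_subset h1.1
  obtain ⟨ε', hε', hball⟩ := Metric.eventually_nhds_iff_ball.1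
    (hht.eventually (ball_mem_nhds x hε))
  have hfront' : ∀ p, h p ∈ frontier S → ‖p‖ < ε' → p.2 = f p.1 := by
    intro p hp hpn
    have h1 : h p ∈ frontier S ∩ ball x ε := ⟨hp, hball p (by simpa using hpn)⟩
    rw [hfr] at h1
    obtain ⟨⟨v, -, hv⟩, -⟩ := h1
    have h2 : h p = h (v, f v) := by
      rw [hv, hh, hΛ]
      exact add_sub_assoc _ _ _
    rw [h.injective h2]
  have hfront : ∀ p ∈ frontier T, ‖p‖ < ε' → p.2 = f p.1 := by
    intro p hp hpn
    rw [hTdef, ← h.preimage_frontier] at hp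
    exact hfront' p hp hpn
  obtain ⟨ρ, hρ, hTf⟩ := hTconv.mem_iff_le_near_graph hTcl hTint hTpos hε' hgraph hfront
  have hmin : IsLocalMin f 0 := by
    filter_upwards [hgraph] with w hw
    rw [hf0]
    exact hTpos _ hw
  obtain ⟨M, hM, hMdet⟩ := exists_sqrt_hessian hfC hmin
  rw [← hkdet] at hMdet
  have hM0 : LinearMap.det M ≠ 0 := fun h0 => by
    rw [h0] at hMdet
    norm_num at hMdet
    exact hk0.ne hMdet
  have hMabs : |LinearMap.det M| = √k := by rw [← hMdet, Real.sqrt_sq_eq_abs]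
  obtain ⟨r₁, hr₁, hvol⟩ := volume_cap_graph hTconv hfC hf0 hf1 hρ hTf hM0 hM
    (η := η / 2) (by linarith)
  set e : ℝ := ((n - 1 : ℕ) : ℝ) / 2 + 1 with he
  have he0 : 0 < e := by positivity
  set C := paraboloidConst (n - 1) / √k with hC
  have hC0 : 0 < C := div_pos (paraboloidConst_pos _) (Real.sqrt_pos.2 hk0)
  rw [hMabs, ← hC] at hvol
  have hfdc : ContinuousAt (fderiv ℝ f) 0 :=
    (hfC.fderiv_right (m := 1) (by norm_num)).continuousAt
  let β : Euc (n - 1) → ℝ := fun w => √(1 + ‖fderiv ℝ f w‖ ^ 2)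
  have hβ1 : ∀ w, 1 ≤ β w := fun w => by
    rw [Real.one_le_sqrt]
    nlinarith [sq_nonneg ‖fderiv ℝ f w‖]
  have hβc : ContinuousAt β 0 := by
    have : ContinuousAt (fun w => 1 + ‖fderiv ℝ f w‖ ^ 2) 0 :=
      continuousAt_const.add (hfdc.norm.pow 2)
    exact this.sqrt
  have hβ0 : β 0 = 1 := by simp [β, hf1]
  have ev1 : ∀ᶠ w in 𝓝 (0 : Euc (n - 1)), (1 + η / 2) * β w ^ e < 1 + η := by
    have : ContinuousAt (fun w => (1 + η / 2) * β w ^ e) 0 :=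
      continuousAt_const.mul (hβc.rpow_const (Or.inr he0.le))
    exact this.tendsto.eventually_lt_const (by simp only [hβ0, Real.one_rpow]; linarith)
  have ev2 : ∀ᶠ w in 𝓝 (0 : Euc (n - 1)), β w < 2 :=
    hβc.tendsto.eventually_lt_const (by rw [hβ0]; norm_num)
  have ev3 : ∀ᶠ w in 𝓝 (0 : Euc (n - 1)), ‖x‖ * √(2 - 2 * (β w)⁻¹) < η / 2 := by
    have : ContinuousAt (fun w => ‖x‖ * √(2 - 2 * (β w)⁻¹)) 0 := by
      refine continuousAt_const.mul (ContinuousAt.sqrt (continuousAt_const.sub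
        (continuousAt_const.mul (hβc.inv₀ ?_))))
      rw [hβ0]
      exact one_ne_zero
    exact this.tendsto.eventually_lt_const (by simp [hβ0, hη])
  have ev4 : ∀ᶠ w in 𝓝 (0 : Euc (n - 1)), DifferentiableAt ℝ f w :=
    (hfC.eventually (by simp)).mono fun w hw => hw.differentiableAt (by norm_num)
  have ev5 : ∀ᶠ w in 𝓝 (0 : Euc (n - 1)), w ∈ ball (0 : Euc (n - 1)) r₁ := ball_mem_nhds _ hr₁
  have ev6 := hgt.eventually (ball_mem_nhds 0 hρ)
  have hsymm : Tendsto h.symm (𝓝 x) (𝓝 0) := by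
    have := h.symm.continuous.tendsto (h 0)
    rwa [h.symm_apply_apply, hh, map_zero, add_zero] at this
  have hfst : Tendsto (fun y => (h.symm y).1) (𝓝 x) (𝓝 0) :=
    (continuous_fst.tendsto (0 : Euc (n - 1) × ℝ)).comp hsymm
  obtain ⟨r₂, hr₂, hev⟩ := Metric.eventually_nhds_iff_ball.1
    ((hfst.eventually (ev1.and (ev2.and (ev3.and (ev4.and (ev5.and ev6)))))).and
      (hsymm.eventually (ball_mem_nhds 0 hε')))
  refine ⟨min (min r₂ (r₁ / 2)) (η / 2), by positivity, fun y hy hyx v hv => ?_⟩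
  rw [lt_min_iff, lt_min_iff] at hyx
  obtain ⟨⟨h1, h2, h3, h4, h5, h6⟩, h7⟩ := hev y hyx.1.1
  set p₀ := h.symm y with hp₀
  set w₀ := p₀.1 with hw₀
  have hyp : h p₀ = y := h.apply_symm_apply y
  have hz₀ : p₀.2 = f w₀ := hfront' p₀ (by rwa [hyp]) (by simpa using h7)
  have hp₀' : p₀ = (w₀, f w₀) := Prod.ext rfl hz₀
  have hy' : y = x + Λ (w₀, f w₀) := by rw [← hyp, hh, ← hp₀']
  obtain ⟨hv1, hvS⟩ := hv
  obtain ⟨hα0, hα1, hαp⟩ := normal_near_graph L hν1 hL Λ hΛ hTf h6 h4 hv1 (fun p hp => by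
    have := hvS _ hp
    rw [hh, hy', inner_add_left, inner_add_left] at this
    rw [inner_sub_left]
    linarith)
  set α := ⟪ν, v⟫ with hα
  have hαβ : (β w₀)⁻¹ ≤ α := by
    have hβp : 0 < β w₀ := by linarith [hβ1 w₀]
    rw [inv_le_iff_one_le_mul₀ hβp]
    have : 1 ≤ (α * β w₀) ^ 2 := by
      rw [mul_pow, Real.sq_sqrt (by positivity)]
      exact hα1
    nlinarith [mul_pos hα0 hβp]
  have hα_le : α ≤ 1 := by
    have := real_inner_le_norm ν v
    rwa [hν1, hv1, one_mul] at this
  have hinv : α⁻¹ ≤ β w₀ := by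
    rw [inv_le_comm₀ hα0 (by linarith [hβ1 w₀])]
    exact hαβ
  constructor
  · have e1 : ⟪y, v⟫ - ⟪x, ν⟫ = ⟪y - x, v⟫ + ⟪x, v - ν⟫ := by
      rw [inner_sub_left, inner_sub_right]
      ring
    have e2 : ‖v - ν‖ = √(2 - 2 * α) := by
      rw [eq_comm, Real.sqrt_eq_iff_mul_self_eq (by linarith) (norm_nonneg _), ← sq,
        norm_sub_sq_real, hv1, hν1, hα, real_inner_comm]
      ring
    have e3 : √(2 - 2 * α) ≤ √(2 - 2 * (β w₀)⁻¹) := Real.sqrt_le_sqrt (by linarith)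
    have e4 : |⟪y - x, v⟫| ≤ dist y x := by
      have := abs_real_inner_le_norm (y - x) v
      rwa [hv1, mul_one, ← dist_eq_norm] at this
    have e5 : |⟪x, v - ν⟫| ≤ ‖x‖ * √(2 - 2 * (β w₀)⁻¹) :=
      (abs_real_inner_le_norm x (v - ν)).trans (by rw [e2]; gcongr)
    rw [e1]
    calc _ ≤ |⟪y - x, v⟫| + |⟪x, v - ν⟫| := abs_add_le _ _
      _ < η := by linarith
  · intro Δ hΔ0 hΔ
    rw [lt_min_iff, lt_min_iff] at hΔ
    have hcap : volume (S ∩ {q | ⟪y, v⟫ - Δ ≤ ⟪v, q⟫})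
        = volume (T ∩ {p | p.2 - f w₀ - fderiv ℝ f w₀ (p.1 - w₀) ≤ Δ / α}) := by
      have hmp : MeasurePreserving h volume volume :=
        (measurePreserving_add_left volume x).comp hΛmp
      have hms : MeasurableSet (S ∩ {q | ⟪y, v⟫ - Δ ≤ ⟪v, q⟫}) :=
        hcomp.isClosed.measurableSet.inter
          (isClosed_le continuous_const (by fun_prop)).measurableSet
      rw [← hmp.measure_preimage hms.nullMeasurableSet, preimage_inter]
      congr 2
      ext p
      have : ⟪v, h p⟫ = ⟪y, v⟫ - α * (p.2 - f w₀ - fderiv ℝ f w₀ (p.1 - w₀)) := by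
        rw [real_inner_comm, hy', hh, inner_add_left, inner_add_left, hαp, hαp, map_sub]
        ring
      simp only [mem_preimage, mem_ofPred_eq, this]
      rw [le_div_iff₀ hα0]
      constructor <;> intro h <;> linarith
    have hΔα : Δ / α < r₁ := by
      rw [div_eq_mul_inv]
      have h7 : Δ * α⁻¹ ≤ Δ * 2 := mul_le_mul_of_nonneg_left (by linarith) hΔ0.le
      linarith [hΔ.1.2]
    obtain ⟨hlo, hup⟩ := hvol w₀ h5 (Δ / α) (by positivity) hΔα
    rw [hcap]
    have hΔe : 0 < Δ ^ e := Real.rpow_pos_of_pos hΔ0 e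
    constructor
    · refine le_trans (ENNReal.ofReal_le_ofReal ?_) hlo
      have : Δ ^ e ≤ (Δ / α) ^ e := by
        apply Real.rpow_le_rpow hΔ0.le _ he0.le
        rw [le_div_iff₀ hα0]
        exact mul_le_of_le_one_right hΔ0.le hα_le
      have h0 : 0 ≤ 1 - η := by linarith
      exact mul_le_mul (by linarith) (mul_le_mul_of_nonneg_left this hC0.le) (by positivity)
        (by linarith)
    · refine hup.trans (ENNReal.ofReal_le_ofReal ?_)
      have : (Δ / α) ^ e ≤ β w₀ ^ e * Δ ^ e := by
        rw [div_eq_inv_mul, Real.mul_rpow (by positivity) hΔ0.le]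
        gcongr
      calc (1 + η / 2) * (C * (Δ / α) ^ e) ≤ (1 + η / 2) * (C * (β w₀ ^ e * Δ ^ e)) := by gcongr
        _ = ((1 + η / 2) * β w₀ ^ e) * (C * Δ ^ e) := by ring
        _ ≤ _ := by gcongr

theorem IsSymConvexBody.zero_mem_interior {n : ℕ} {S : Set (Euc n)} (hS : IsSymConvexBody S) :
    (0 : Euc n) ∈ interior S := by
  obtain ⟨-, hconv, ⟨z, hz⟩, hsymm⟩ := hS
  have hz' : -z ∈ S := by
    rw [hsymm]
    simpa using interior_subset hz
  have h := hconv.openSegment_interior_self_subset_interior hz hz'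
  refine h ⟨1 / 2, 1 / 2, by norm_num, by norm_num, by norm_num, ?_⟩
  simp

theorem IsOuterNormalAt.inner_pos {n : ℕ} {S : Set (Euc n)} (hS : IsSymConvexBody S)
    {y v : Euc n} (hv : IsOuterNormalAt S y v) : 0 < ⟪y, v⟫ := by
  obtain ⟨ε, hε, hball⟩ := Metric.isOpen_iff.1 isOpen_interior _ hS.zero_mem_interior
  have hmem : (ε / 2) • v ∈ S := by
    refine interior_subset (hball ?_)
    rw [mem_ball_zero_iff, norm_smul, hv.1, mul_one, Real.norm_of_nonneg (by positivity)]
    linarith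
  have h := hv.2 _ hmem
  rw [real_inner_smul_left, real_inner_self_eq_norm_sq, hv.1] at h
  linarith

theorem IsSymConvexBody.volume_pos {n : ℕ} {S : Set (Euc n)} (hS : IsSymConvexBody S) :
    0 < (volume S).toReal :=
  ENNReal.toReal_pos ((isOpen_interior.measure_pos volume hS.2.2.1).trans_le
    (measure_mono interior_subset)).ne' hS.1.measure_lt_top.ne

theorem cConst_pos {n : ℕ} {S : Set (Euc n)} (hS : IsSymConvexBody S) : 0 < cConst n S := by
  have hB : 0 < (volume (ball (0 : Euc (n - 1)) 1)).toReal :=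
    ENNReal.toReal_pos (measure_ball_pos _ _ one_pos).ne' measure_ball_lt_top.ne
  have hV := hS.volume_pos
  unfold cConst
  positivity

theorem paraboloidConst_div_sqrt_mul {n : ℕ} (hn : 2 ≤ n) {S : Set (Euc n)}
    (hS : IsSymConvexBody S) {k a s : ℝ} (hk : 0 < k) (ha : 0 < a) (hs : 0 < s) :
    paraboloidConst (n - 1) / √k * (s * a) ^ (((n - 1 : ℕ) : ℝ) / 2 + 1)
      = (volume S).toReal *
        (s / (cConst n S * k ^ ((1 : ℝ) / (n + 1)) / a)) ^ (((n - 1 : ℕ) : ℝ) / 2 + 1) := by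
  have hB : 0 < (volume (ball (0 : Euc (n - 1)) 1)).toReal :=
    ENNReal.toReal_pos (measure_ball_pos _ _ one_pos).ne' measure_ball_lt_top.ne
  have hV := hS.volume_pos
  have hc := cConst_pos hS
  have hn0 : (0 : ℝ) < n + 1 := by positivity
  have he : ((n - 1 : ℕ) : ℝ) / 2 + 1 = ((n : ℝ) + 1) / 2 := by
    rw [Nat.cast_sub (by omega)]
    push_cast
    ring
  have he' : ((n - 1 : ℕ) : ℝ) / 2 = ((n : ℝ) + 1) / 2 - 1 := by linarith
  have hroot : ∀ z : ℝ, 0 < z → (z ^ ((2 : ℝ) / (n + 1))) ^ (((n : ℝ) + 1) / 2) = z := by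
    intro z hz
    rw [← Real.rpow_mul hz.le, div_mul_div_cancel₀ hn0.ne', div_self two_ne_zero, Real.rpow_one]
  have hk' : (k ^ ((1 : ℝ) / (n + 1))) ^ (((n : ℝ) + 1) / 2) = √k := by
    rw [← Real.rpow_mul hk.le, div_mul_div_cancel₀ hn0.ne', Real.sqrt_eq_rpow]
  have h2 : (0 : ℝ) < 2 ^ (((n : ℝ) + 1) / 2) := by positivity
  have hsk : 0 < √k := Real.sqrt_pos.2 hk
  have hcc : cConst n S ^ (((n : ℝ) + 1) / 2) = ((n : ℝ) + 1) / 2 ^ (((n : ℝ) + 1) / 2) *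
      ((volume S).toReal / (volume (ball (0 : Euc (n - 1)) 1)).toReal) := by
    unfold cConst
    rw [Real.mul_rpow (by positivity) (by positivity), Real.div_rpow (by positivity) (by norm_num),
      hroot _ hn0, hroot _ (by positivity)]
  have hdiv : s / (cConst n S * k ^ ((1 : ℝ) / (n + 1)) / a)
      = s * a / (cConst n S * k ^ ((1 : ℝ) / (n + 1))) := by
    rw [div_div_eq_mul_div]
  rw [he, hdiv, Real.div_rpow (by positivity) (by positivity), Real.mul_rpow hc.le (by positivity),
    hk', hcc]
  unfold paraboloidConst
  rw [he, he', Real.rpow_sub_one two_ne_zero]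
  field_simp

/-- Sharp local asymptotics of the caps of relative height `s`. -/
theorem volume_relative_cap_near {n : ℕ} (hn : 2 ≤ n) {S : Set (Euc n)} {u : Euc n → Euc n}
    {κ : Euc n → ℝ} (hS : IsSymConvexBody S) (hC2 : IsC2Body S u κ)
    (hκ : ∀ x ∈ frontier S, 0 < κ x) {x : Euc n} (hx : x ∈ frontier S) {η : ℝ} (hη : 0 < η) :
    ∃ r > 0, ∀ y ∈ frontier S, dist y x < r → ∀ v, IsOuterNormalAt S y v → ∀ s, 0 < s → s < r →
      ENNReal.ofReal ((1 - η) * ((volume S).toReal *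
          (s / Gfun S u κ x) ^ (((n - 1 : ℕ) : ℝ) / 2 + 1)))
        ≤ volume (S ∩ {q | (1 - s) * ⟪y, v⟫ ≤ ⟪v, q⟫}) ∧
      volume (S ∩ {q | (1 - s) * ⟪y, v⟫ ≤ ⟪v, q⟫})
        ≤ ENNReal.ofReal ((1 + η) * ((volume S).toReal *
          (s / Gfun S u κ x) ^ (((n - 1 : ℕ) : ℝ) / 2 + 1))) := by
  obtain ⟨hν, hk⟩ := hC2 x hx
  have ha : 0 < ⟪x, u x⟫ := hν.inner_pos hS
  set a := ⟪x, u x⟫ with ha_def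
  set e : ℝ := ((n - 1 : ℕ) : ℝ) / 2 + 1 with he
  have he0 : 0 < e := by positivity
  have ev1 : ∀ᶠ t in 𝓝[>] (0 : ℝ), (1 + t) * ((a + t) / a) ^ e < 1 + η := by
    have hc : ContinuousAt (fun t : ℝ => (1 + t) * ((a + t) / a) ^ e) 0 := by
      refine ContinuousAt.mul (by fun_prop) (ContinuousAt.rpow_const (by fun_prop) ?_)
      left
      simp [ha.ne']
    refine (hc.eventually_lt_const ?_).filter_mono nhdsWithin_le_nhds
    simp [ha.ne', hη]
  have ev2 : ∀ᶠ t in 𝓝[>] (0 : ℝ), 1 - η < (1 - t) * ((a - t) / a) ^ e := by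
    have hc : ContinuousAt (fun t : ℝ => (1 - t) * ((a - t) / a) ^ e) 0 := by
      refine ContinuousAt.mul (by fun_prop) (ContinuousAt.rpow_const (by fun_prop) ?_)
      left
      simp [ha.ne']
    refine (hc.eventually_const_lt ?_).filter_mono nhdsWithin_le_nhds
    simp [ha.ne', hη]
  have ev3 : ∀ᶠ t in 𝓝[>] (0 : ℝ), t < min 1 a :=
    (eventually_lt_nhds (lt_min one_pos ha)).filter_mono nhdsWithin_le_nhds
  obtain ⟨t, h1, h2, h3, ht⟩ :=
    (ev1.and (ev2.and (ev3.and self_mem_nhdsWithin))).exists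
  have ht0 : 0 < t := ht
  rw [lt_min_iff] at h3
  obtain ⟨r, hr, hcap⟩ := volume_cap_near hn hS hν hk (hκ x hx) ht0 h3.1
  refine ⟨min r (r / (a + t)), lt_min hr (by positivity), ?_⟩
  intro y hy hyx v hv s hs0 hs
  rw [lt_min_iff] at hyx hs
  obtain ⟨hclose, hcap⟩ := hcap y hy hyx.1 v hv
  rw [abs_lt] at hclose
  set b := ⟪y, v⟫ with hb_def
  have hb : 0 < b := hv.inner_pos hS
  have hsb : s * b < r := by
    have h4 := (lt_div_iff₀ (by positivity)).1 hs.2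
    have h5 : s * b ≤ s * (a + t) := mul_le_mul_of_nonneg_left (by linarith) hs0.le
    linarith
  obtain ⟨hlo, hup⟩ := hcap (s * b) (by positivity) hsb
  have hset : (1 - s) * b = b - s * b := by ring
  have hsplit : s * b = (s * a) * (b / a) := by field_simp
  have hval : paraboloidConst (n - 1) / √(κ x) * (s * b) ^ e
      = (volume S).toReal * (s / Gfun S u κ x) ^ e * (b / a) ^ e := by
    rw [hsplit, Real.mul_rpow (by positivity) (by positivity), ← mul_assoc, he,
      paraboloidConst_div_sqrt_mul hn hS (hκ x hx) ha hs0]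
    rfl
  rw [hval] at hlo hup
  have hG : 0 < Gfun S u κ x :=
    div_pos (mul_pos (cConst_pos hS) (Real.rpow_pos_of_pos (hκ x hx) _)) ha
  have hV := hS.volume_pos
  set W := (volume S).toReal * (s / Gfun S u κ x) ^ e with hW
  have hW0 : 0 ≤ W := by positivity
  rw [hset]
  constructor
  · refine le_trans (ENNReal.ofReal_le_ofReal ?_) hlo
    have h6 : ((a - t) / a) ^ e ≤ (b / a) ^ e :=
      Real.rpow_le_rpow (div_nonneg (by linarith) ha.le) (by gcongr; linarith) he0.le
    calc (1 - η) * W ≤ ((1 - t) * (b / a) ^ e) * W := by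
          refine mul_le_mul_of_nonneg_right (h2.le.trans ?_) hW0
          exact mul_le_mul_of_nonneg_left h6 (by linarith)
      _ = _ := by ring
  · refine hup.trans (ENNReal.ofReal_le_ofReal ?_)
    have h6 : (b / a) ^ e ≤ ((a + t) / a) ^ e :=
      Real.rpow_le_rpow (by positivity) (by gcongr; linarith) he0.le
    calc _ = ((1 + t) * (b / a) ^ e) * W := by ring
      _ ≤ (1 + η) * W := by
          refine mul_le_mul_of_nonneg_right (le_trans ?_ h1.le) hW0
          exact mul_le_mul_of_nonneg_left h6 (by linarith)

theorem Gfun_pos {n : ℕ} {S : Set (Euc n)} {u : Euc n → Euc n} {κ : Euc n → ℝ}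
    (hS : IsSymConvexBody S) (hC2 : IsC2Body S u κ) (hκ : ∀ x ∈ frontier S, 0 < κ x)
    {x : Euc n} (hx : x ∈ frontier S) : 0 < Gfun S u κ x :=
  div_pos (mul_pos (cConst_pos hS) (Real.rpow_pos_of_pos (hκ x hx) _))
    ((hC2 x hx).1.inner_pos hS)

theorem le_three_mul_of_rpow_bounds {V s a b e : ℝ} (hV : 0 < V) (hs : 0 < s) (ha : 0 < a)
    (hb : 0 < b) (he : 1 ≤ e)
    (h : (1 - 1 / 2) * (V * (s / a) ^ e) ≤ (1 + 1 / 2) * (V * (s / b) ^ e)) : b ≤ 3 * a := by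
  have he0 : 0 < e := by linarith
  have hse : 0 < s ^ e := Real.rpow_pos_of_pos hs e
  have hae : 0 < a ^ e := Real.rpow_pos_of_pos ha e
  have hbe : 0 < b ^ e := Real.rpow_pos_of_pos hb e
  rw [Real.div_rpow hs.le ha.le, Real.div_rpow hs.le hb.le] at h
  have h1 : (s ^ e / a ^ e) ≤ 3 * (s ^ e / b ^ e) := by
    refine le_of_mul_le_mul_left ?_ hV
    linarith
  have h2 : b ^ e ≤ 3 * a ^ e := by
    rw [div_le_iff₀ hae] at h1
    have h3 : s ^ e * b ^ e ≤ s ^ e * (3 * a ^ e) := by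
      calc s ^ e * b ^ e ≤ (3 * (s ^ e / b ^ e) * a ^ e) * b ^ e :=
            mul_le_mul_of_nonneg_right h1 hbe.le
        _ = _ := by field_simp
    exact le_of_mul_le_mul_left h3 hse
  have h3 : (3 : ℝ) ≤ 3 ^ e := Real.self_le_rpow_of_one_le (by norm_num) he
  have h4 : b ^ e ≤ (3 * a) ^ e := by
    rw [Real.mul_rpow (by norm_num) ha.le]
    exact h2.trans (mul_le_mul_of_nonneg_right h3 hae.le)
  exact (Real.rpow_le_rpow_iff hb.le (by positivity) he0).1 h4

theorem exists_bounds_Gfun {n : ℕ} (hn : 2 ≤ n) {S : Set (Euc n)} {u : Euc n → Euc n}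
    {κ : Euc n → ℝ} (hS : IsSymConvexBody S) (hC2 : IsC2Body S u κ)
    (hκ : ∀ x ∈ frontier S, 0 < κ x) :
    ∃ m > 0, ∃ M, ∀ y ∈ frontier S, m ≤ Gfun S u κ y ∧ Gfun S u κ y ≤ M := by
  have hcomp : IsCompact (frontier S) :=
    hS.1.of_isClosed_subset isClosed_frontier hS.1.isClosed.frontier_subset
  refine hcomp.induction_on
    (p := fun t => ∃ m > 0, ∃ M, ∀ y ∈ t, m ≤ Gfun S u κ y ∧ Gfun S u κ y ≤ M) ?_ ?_ ?_ ?_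
  · exact ⟨1, one_pos, 0, by simp⟩
  · rintro s t hst ⟨m, hm, M, h⟩
    exact ⟨m, hm, M, fun y hy => h y (hst hy)⟩
  · rintro s t ⟨m, hm, M, h⟩ ⟨m', hm', M', h'⟩
    refine ⟨min m m', lt_min hm hm', max M M', ?_⟩
    rintro y (hy | hy)
    · exact ⟨(min_le_left _ _).trans (h y hy).1, (h y hy).2.trans (le_max_left _ _)⟩
    · exact ⟨(min_le_right _ _).trans (h' y hy).1, (h' y hy).2.trans (le_max_right _ _)⟩
  · intro x hx
    have hGx := Gfun_pos hS hC2 hκ hx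
    obtain ⟨r, hr, hcap⟩ := volume_relative_cap_near hn hS hC2 hκ hx (η := 1 / 2) (by norm_num)
    refine ⟨frontier S ∩ ball x r, inter_mem_nhdsWithin _ (ball_mem_nhds _ hr),
      Gfun S u κ x / 3, by positivity, 3 * Gfun S u κ x, ?_⟩
    rintro y ⟨hy, hyx⟩
    have hGy := Gfun_pos hS hC2 hκ hy
    obtain ⟨r', hr', hcap'⟩ :=
      volume_relative_cap_near hn hS hC2 hκ hy (η := 1 / 2) (by norm_num)
    obtain ⟨s, hs0, hs⟩ := exists_between (lt_min hr hr')
    rw [lt_min_iff] at hs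
    obtain ⟨hlo, hup⟩ := hcap y hy hyx _ (hC2 y hy).1 s hs0 hs.1
    obtain ⟨hlo', hup'⟩ := hcap' y hy (by simpa using hr') _ (hC2 y hy).1 s hs0 hs.2
    have hV := hS.volume_pos
    have he : (1 : ℝ) ≤ ((n - 1 : ℕ) : ℝ) / 2 + 1 := by
      have : (0 : ℝ) ≤ ((n - 1 : ℕ) : ℝ) / 2 := by positivity
      linarith
    have h1 := (ENNReal.ofReal_le_ofReal_iff (by positivity)).1 (hlo.trans hup')
    have h2 := (ENNReal.ofReal_le_ofReal_iff (by positivity)).1 (hlo'.trans hup)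
    have h3 := le_three_mul_of_rpow_bounds hV hs0 hGx hGy he h1
    have h4 := le_three_mul_of_rpow_bounds hV hs0 hGy hGx he h2
    constructor <;> linarith

theorem exists_uniform_volume_relative_cap {n : ℕ} (hn : 2 ≤ n) {S : Set (Euc n)}
    {u : Euc n → Euc n} {κ : Euc n → ℝ} (hS : IsSymConvexBody S) (hC2 : IsC2Body S u κ)
    (hκ : ∀ x ∈ frontier S, 0 < κ x) {m M : ℝ} (hm : 0 < m)
    (hmM : ∀ y ∈ frontier S, m ≤ Gfun S u κ y ∧ Gfun S u κ y ≤ M) {η : ℝ} (hη : 0 < η)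
    (hη1 : η < 1) :
    ∃ r > 0, ∀ y ∈ frontier S, ∀ v, IsOuterNormalAt S y v → ∀ s, 0 < s → s < r →
      ENNReal.ofReal ((1 - η) * ((volume S).toReal * (s / M) ^ (((n - 1 : ℕ) : ℝ) / 2 + 1)))
        ≤ volume (S ∩ {q | (1 - s) * ⟪y, v⟫ ≤ ⟪v, q⟫}) ∧
      volume (S ∩ {q | (1 - s) * ⟪y, v⟫ ≤ ⟪v, q⟫})
        ≤ ENNReal.ofReal ((1 + η) * ((volume S).toReal *
          (s / m) ^ (((n - 1 : ℕ) : ℝ) / 2 + 1))) := by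
  have hcomp : IsCompact (frontier S) :=
    hS.1.of_isClosed_subset isClosed_frontier hS.1.isClosed.frontier_subset
  refine hcomp.induction_on (p := fun t => ∃ r > 0, ∀ y ∈ t, ∀ v, IsOuterNormalAt S y v →
    ∀ s, 0 < s → s < r →
      ENNReal.ofReal ((1 - η) * ((volume S).toReal * (s / M) ^ (((n - 1 : ℕ) : ℝ) / 2 + 1)))
        ≤ volume (S ∩ {q | (1 - s) * ⟪y, v⟫ ≤ ⟪v, q⟫}) ∧
      volume (S ∩ {q | (1 - s) * ⟪y, v⟫ ≤ ⟪v, q⟫})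
        ≤ ENNReal.ofReal ((1 + η) * ((volume S).toReal *
          (s / m) ^ (((n - 1 : ℕ) : ℝ) / 2 + 1)))) ?_ ?_ ?_ ?_
  · exact ⟨1, one_pos, by simp⟩
  · rintro s t hst ⟨r, hr, h⟩
    exact ⟨r, hr, fun y hy => h y (hst hy)⟩
  · rintro s t ⟨r, hr, h⟩ ⟨r', hr', h'⟩
    refine ⟨min r r', lt_min hr hr', ?_⟩
    rintro y (hy | hy) v hv s hs0 hs
    · exact h y hy v hv s hs0 (hs.trans_le (min_le_left _ _))
    · exact h' y hy v hv s hs0 (hs.trans_le (min_le_right _ _))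
  · intro x hx
    obtain ⟨hmx, hMx⟩ := hmM x hx
    have hGx := Gfun_pos hS hC2 hκ hx
    have hV := hS.volume_pos
    obtain ⟨r, hr, hcap⟩ := volume_relative_cap_near hn hS hC2 hκ hx hη
    refine ⟨frontier S ∩ ball x r, inter_mem_nhdsWithin _ (ball_mem_nhds _ hr), r, hr, ?_⟩
    rintro y ⟨hy, hyx⟩ v hv s hs0 hs
    obtain ⟨hlo, hup⟩ := hcap y hy hyx v hv s hs0 hs
    have h0 : 0 ≤ 1 - η := by linarith
    have hM : 0 < M := hGx.trans_le hMx
    exact ⟨le_trans (by gcongr) hlo, hup.trans (by gcongr)⟩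

theorem exists_support_point {n : ℕ} {S : Set (Euc n)} (hS : IsSymConvexBody S) {v : Euc n}
    (hv : v ≠ 0) : ∃ y ∈ frontier S, IsOuterNormalAt S y (‖v‖⁻¹ • v) := by
  have hvn : 0 < ‖v‖ := norm_pos_iff.2 hv
  obtain ⟨y, hyS, hy⟩ := hS.1.exists_isMaxOn (hS.2.2.1.mono interior_subset)
    (f := fun z => ⟪z, v⟫) (by fun_prop)
  have hmax : ∀ z ∈ S, ⟪z, v⟫ ≤ ⟪y, v⟫ := fun z hz => hy hz
  refine ⟨y, ⟨subset_closure hyS, fun hyi => ?_⟩, ?_, fun z hz => ?_⟩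
  · have hc : Tendsto (fun t : ℝ => y + t • v) (𝓝[>] 0) (𝓝 y) := by
      have : Continuous fun t : ℝ => y + t • v := by fun_prop
      exact (this.tendsto' 0 y (by simp)).mono_left nhdsWithin_le_nhds
    obtain ⟨t, ht, ht0⟩ := ((hc.eventually (isOpen_interior.mem_nhds hyi)).and
      self_mem_nhdsWithin).exists
    have h := hmax _ (interior_subset ht)
    rw [inner_add_left, real_inner_smul_left, real_inner_self_eq_norm_sq] at h
    have : 0 < t * ‖v‖ ^ 2 := mul_pos ht0 (by positivity)
    linarith
  · rw [norm_smul, norm_inv, norm_norm, inv_mul_cancel₀ hvn.ne']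
  · rw [real_inner_smul_right, real_inner_smul_right]
    exact mul_le_mul_of_nonneg_left (hmax z hz) (by positivity)

theorem exists_volume_directional_cap {n : ℕ} (hn : 2 ≤ n) {S : Set (Euc n)}
    {u : Euc n → Euc n} {κ : Euc n → ℝ} (hS : IsSymConvexBody S) (hC2 : IsC2Body S u κ)
    (hκ : ∀ x ∈ frontier S, 0 < κ x) {m M : ℝ} (hm : 0 < m)
    (hmM : ∀ y ∈ frontier S, m ≤ Gfun S u κ y ∧ Gfun S u κ y ≤ M) {η : ℝ} (hη : 0 < η)
    (hη1 : η < 1) :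
    ∃ r > 0, ∀ v : Euc n, v ≠ 0 → ∃ y ∈ S, (∀ z ∈ S, ⟪v, z⟫ ≤ ⟪v, y⟫) ∧ 0 < ⟪v, y⟫ ∧
      ∀ s, 0 < s → s < r →
      ENNReal.ofReal ((1 - η) * ((volume S).toReal * (s / M) ^ (((n - 1 : ℕ) : ℝ) / 2 + 1)))
        ≤ volume (S ∩ {q | (1 - s) * ⟪v, y⟫ ≤ ⟪v, q⟫}) ∧
      volume (S ∩ {q | (1 - s) * ⟪v, y⟫ ≤ ⟪v, q⟫})
        ≤ ENNReal.ofReal ((1 + η) * ((volume S).toReal *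
          (s / m) ^ (((n - 1 : ℕ) : ℝ) / 2 + 1))) := by
  obtain ⟨r, hr, hcap⟩ := exists_uniform_volume_relative_cap hn hS hC2 hκ hm hmM hη hη1
  refine ⟨r, hr, fun v hv => ?_⟩
  have hvn : 0 < ‖v‖ := norm_pos_iff.2 hv
  obtain ⟨y, hy, hyv⟩ := exists_support_point hS hv
  have hpos := hyv.inner_pos hS
  have hinner : ∀ z, ⟪z, ‖v‖⁻¹ • v⟫ = ‖v‖⁻¹ * ⟪v, z⟫ := fun z => by
    rw [real_inner_smul_right, real_inner_comm]
  refine ⟨y, hS.1.isClosed.frontier_subset hy, fun z hz => ?_, ?_, fun s hs0 hs => ?_⟩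
  · have h := hyv.2 z hz
    rw [hinner, hinner] at h
    exact le_of_mul_le_mul_left h (inv_pos.2 hvn)
  · rw [hinner] at hpos
    exact pos_of_mul_pos_right hpos (inv_pos.2 hvn).le
  · have hset : {q | (1 - s) * ⟪y, ‖v‖⁻¹ • v⟫ ≤ ⟪‖v‖⁻¹ • v, q⟫}
        = {q | (1 - s) * ⟪v, y⟫ ≤ ⟪v, q⟫} := by
      ext q
      simp only [mem_ofPred_eq]
      rw [hinner, real_inner_smul_left, mul_left_comm, mul_le_mul_iff_right₀ (inv_pos.2 hvn)]
    rw [← hset]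
    exact hcap y hy _ hyv s hs0 hs

theorem exists_floatingBody_inclusions {n : ℕ} (hn : 2 ≤ n) {S : Set (Euc n)}
    {u : Euc n → Euc n} {κ : Euc n → ℝ} (hS : IsSymConvexBody S) (hC2 : IsC2Body S u κ)
    (hκ : ∀ x ∈ frontier S, 0 < κ x) {m M : ℝ} (hm : 0 < m) (hM : 0 < M)
    (hmM : ∀ y ∈ frontier S, m ≤ Gfun S u κ y ∧ Gfun S u κ y ≤ M) {η : ℝ} (hη : 0 < η)
    (hη1 : η < 1) :
    ∃ δ₀ > (0 : ℝ), ∀ δ, 0 < δ → δ < δ₀ →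
      (1 - (1 + η) * M * δ ^ ((2 : ℝ) / (n + 1))) • S ⊆ floatingBody S δ ∧
      floatingBody S δ ⊆ (1 - (1 - η) * m * δ ^ ((2 : ℝ) / (n + 1))) • S := by
  obtain ⟨r, hr, hcap⟩ := exists_volume_directional_cap hn hS hC2 hκ hm hmM
    (η := η / 2) (by linarith) (by linarith)
  have hp : (0 : ℝ) < 2 / (n + 1) := by positivity
  have htend : Tendsto (fun δ : ℝ => δ ^ ((2 : ℝ) / (n + 1))) (𝓝 0) (𝓝 0) := by
    have := (Real.continuous_rpow_const hp.le).tendsto (0 : ℝ)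
    rwa [Real.zero_rpow hp.ne'] at this
  have hev : ∀ᶠ δ in 𝓝 (0 : ℝ),
      (1 + η) * M * δ ^ ((2 : ℝ) / (n + 1)) < min r 1 ∧
      (1 - η) * m * δ ^ ((2 : ℝ) / (n + 1)) < min r 1 := by
    have hpos : (0 : ℝ) < min r 1 := lt_min hr one_pos
    refine ((htend.const_mul _).eventually_lt_const ?_).and
      ((htend.const_mul _).eventually_lt_const ?_) <;> simpa using hpos
  obtain ⟨δ₀, hδ₀, hball⟩ := Metric.eventually_nhds_iff.1 hev
  refine ⟨δ₀, hδ₀, fun δ hδ0 hδ => ?_⟩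
  obtain ⟨h1, h2⟩ := @hball δ (by rwa [Real.dist_0_eq_abs, abs_of_pos hδ0])
  set t := δ ^ ((2 : ℝ) / (n + 1)) with ht
  set e : ℝ := ((n - 1 : ℕ) : ℝ) / 2 + 1 with he
  have he1 : 1 ≤ e := by
    have : (0 : ℝ) ≤ ((n - 1 : ℕ) : ℝ) / 2 := by positivity
    linarith
  have ht0 : 0 < t := Real.rpow_pos_of_pos hδ0 _
  have hte : t ^ e = δ := by
    have he' : e = ((n : ℝ) + 1) / 2 := by
      rw [he, Nat.cast_sub (by omega)]
      push_cast
      ring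
    have hn0 : (0 : ℝ) < n + 1 := by positivity
    rw [he', ht, ← Real.rpow_mul hδ0.le, div_mul_div_cancel₀ hn0.ne', div_self two_ne_zero,
      Real.rpow_one]
  have hV := hS.volume_pos
  have hvol : ENNReal.ofReal δ * volume S = ENNReal.ofReal (δ * (volume S).toReal) := by
    rw [ENNReal.ofReal_mul hδ0.le, ENNReal.ofReal_toReal hS.1.measure_lt_top.ne]
  have hδV : 0 < δ * (volume S).toReal := mul_pos hδ0 hV
  rw [lt_min_iff] at h1 h2
  have hη' : 0 < 1 - η := by linarith
  constructor
  · rintro _ ⟨x, hx, rfl⟩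
    refine mem_iInter₂.2 fun v hv => mem_iInter₂.2 fun c hc => ?_
    by_contra hlt
    simp only [mem_ofPred_eq, not_le, real_inner_smul_right] at hlt
    obtain ⟨y, -, hmax, hpos, hy⟩ := hcap v hv
    have hlo := (hy _ (by positivity) h1.1).1
    have hcle : c ≤ (1 - (1 + η) * M * t) * ⟪v, y⟫ :=
      hlt.le.trans (mul_le_mul_of_nonneg_left (hmax x hx) (by linarith))
    have hsub : S ∩ {q | (1 - (1 + η) * M * t) * ⟪v, y⟫ ≤ ⟪v, q⟫} ⊆ S ∩ {q | c ≤ ⟪v, q⟫} :=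
      inter_subset_inter_right _ fun q hq => hcle.trans hq
    have hfin := (hlo.trans (measure_mono hsub)).trans hc
    rw [hvol, ENNReal.ofReal_le_ofReal_iff hδV.le] at hfin
    have hdiv : (1 + η) * M * t / M = (1 + η) * t := by field_simp
    have hge : 1 + η ≤ (1 + η) ^ e := Real.self_le_rpow_of_one_le (by linarith) he1
    rw [hdiv, Real.mul_rpow (by positivity) ht0.le, hte] at hfin
    have h3 : (1 - η / 2) * (1 + η) ≤ (1 - η / 2) * (1 + η) ^ e :=
      mul_le_mul_of_nonneg_left hge (by linarith)
    have h4 : (1 - η / 2) * (1 + η) ^ e ≤ 1 := by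
      refine le_of_mul_le_mul_right ?_ hδV
      linarith
    have h5 : 1 < (1 - η / 2) * (1 + η) := by
      have := mul_pos hη hη'
      linarith
    linarith
  · intro z hz
    by_contra hzS
    have hcomp : IsCompact ((1 - (1 - η) * m * t) • S) := hS.1.smul _
    obtain ⟨f, b, hfb, hbz⟩ :=
      geometric_hahn_banach_closed_point (hS.2.1.smul _) hcomp.isClosed hzS
    set v := (InnerProductSpace.toDual ℝ (Euc n)).symm f with hvdef
    have hfv : ∀ q, f q = ⟪v, q⟫ := fun q => InnerProductSpace.toDual_symm_apply.symm
    have h0 : f 0 < b :=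
      hfb 0 ⟨0, interior_subset hS.zero_mem_interior, smul_zero _⟩
    have hv : v ≠ 0 := by
      intro hv0
      rw [map_zero] at h0
      rw [hfv, hv0, inner_zero_left] at hbz
      linarith
    obtain ⟨y, hyS, -, hpos, hy⟩ := hcap v hv
    have hyb := hfb _ (smul_mem_smul_set (a := 1 - (1 - η) * m * t) hyS)
    rw [hfv, real_inner_smul_right] at hyb
    rw [hfv] at hbz
    have hup := (hy _ (by positivity) h2.1).2
    have hdiv : (1 - η) * m * t / m = (1 - η) * t := by field_simp
    have hle : (1 - η) ^ e ≤ 1 - η :=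
      Real.rpow_le_self_of_le_one hη'.le (by linarith) he1
    rw [hdiv, Real.mul_rpow hη'.le ht0.le, hte] at hup
    have hcapδ : volume (S ∩ {q | (1 - (1 - η) * m * t) * ⟪v, y⟫ ≤ ⟪v, q⟫})
        ≤ ENNReal.ofReal δ * volume S := by
      rw [hvol]
      refine hup.trans (ENNReal.ofReal_le_ofReal ?_)
      have h3 : (1 + η / 2) * (1 - η) ^ e ≤ 1 := by
        have h4 : (1 + η / 2) * (1 - η) ^ e ≤ (1 + η / 2) * (1 - η) :=
          mul_le_mul_of_nonneg_left hle (by linarith)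
        have := mul_pos hη hη
        linarith
      calc _ = ((1 + η / 2) * (1 - η) ^ e) * (δ * (volume S).toReal) := by ring
        _ ≤ 1 * (δ * (volume S).toReal) := mul_le_mul_of_nonneg_right h3 hδV.le
        _ = _ := one_mul _
    have hzc := mem_iInter₂.1 (mem_iInter₂.1 hz v hv) _ hcapδ
    simp only [mem_ofPred_eq] at hzc
    linarith

theorem exists_tendsto_zero_of_eventually {P : ℝ → ℝ → Prop}
    (h : ∀ η : ℝ, 0 < η → η < 1 → ∃ δ₀ > (0 : ℝ), ∀ δ, 0 < δ → δ < δ₀ → P η δ) :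
    ∃ Φ : ℝ → ℝ, (∀ δ, 0 ≤ Φ δ) ∧ Tendsto Φ (𝓝[>] 0) (𝓝 0) ∧
      ∃ δ₀ > (0 : ℝ), ∀ δ, 0 < δ → δ < δ₀ → P (Φ δ) δ := by
  classical
  have h' : ∀ k : ℕ, ∃ δ₀ > (0 : ℝ), ∀ δ, 0 < δ → δ < δ₀ → P (1 / ((k : ℝ) + 2)) δ := fun k =>
    h _ (by positivity) (by
      rw [div_lt_one (by positivity)]
      have : (0 : ℝ) ≤ k := k.cast_nonneg
      linarith)
  choose d hd hP using h'
  let K : ℝ → ℕ := fun δ => Nat.findGreatest (fun k => δ < d k) ⌊δ⁻¹⌋₊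
  refine ⟨fun δ => 1 / ((K δ : ℝ) + 2), fun δ => by positivity, ?_, d 0, hd 0, ?_⟩
  · have hK : Tendsto K (𝓝[>] 0) atTop := by
      refine tendsto_atTop.2 fun k => ?_
      have h1 : ∀ᶠ δ in 𝓝[>] (0 : ℝ), δ < d k :=
        (eventually_lt_nhds (hd k)).filter_mono nhdsWithin_le_nhds
      have h2 : ∀ᶠ δ in 𝓝[>] (0 : ℝ), (k : ℝ) ≤ δ⁻¹ :=
        tendsto_inv_nhdsGT_zero.eventually_ge_atTop _
      filter_upwards [h1, h2] with δ h1 h2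
      exact Nat.le_findGreatest (Nat.le_floor h2) h1
    have hc : Tendsto (fun δ => (K δ : ℝ) + 2) (𝓝[>] 0) atTop :=
      tendsto_atTop_add_const_right _ _ (tendsto_natCast_atTop_atTop.comp hK)
    simp only [one_div]
    exact tendsto_inv_atTop_zero.comp hc
  · intro δ hδ0 hδ
    exact hP _ δ hδ0 (Nat.findGreatest_spec (P := fun k => δ < d k) (Nat.zero_le _) hδ)

/-- Proposition 3.3: for `S` of class `C²₊` there is a nonnegative function `Φ` with `Φ(δ) → 0`
such that `(1 − (1+Φ(δ))G_max δ^{2/(n+1)})S ⊆ S_δ ⊆ (1 − (1−Φ(δ))G_min δ^{2/(n+1)})S`. -/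
theorem statement6 {n : ℕ} (hn : 2 ≤ n) (S : Set (Euc n))
    (u : Euc n → Euc n) (κ : Euc n → ℝ)
    (hS : IsSymConvexBody S) (hC2 : IsC2Body S u κ)
    (hκ : ∀ x ∈ frontier S, 0 < κ x) :
    ∃ Φ : ℝ → ℝ, (∀ δ, 0 ≤ Φ δ) ∧ Tendsto Φ (𝓝[>] 0) (𝓝 0) ∧
      ∃ δ₀ > (0:ℝ), ∀ δ : ℝ, 0 < δ → δ < δ₀ →
        (1 - (1 + Φ δ) * sSup (Gfun S u κ '' frontier S) * δ ^ ((2:ℝ)/(n+1))) • S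
            ⊆ floatingBody S δ ∧
          floatingBody S δ ⊆
            (1 - (1 - Φ δ) * sInf (Gfun S u κ '' frontier S) * δ ^ ((2:ℝ)/(n+1))) • S := by
  obtain ⟨m, hm, M, hmM⟩ := exists_bounds_Gfun hn hS hC2 hκ
  obtain ⟨y, hy, -⟩ := exists_support_point hS
    (v := EuclideanSpace.single (⟨0, by omega⟩ : Fin n) (1 : ℝ)) (by simp)
  have hbelow : BddBelow (Gfun S u κ '' frontier S) :=
    ⟨m, forall_mem_image.2 fun x hx => (hmM x hx).1⟩
  have habove : BddAbove (Gfun S u κ '' frontier S) :=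
    ⟨M, forall_mem_image.2 fun x hx => (hmM x hx).2⟩
  have hinf : 0 < sInf (Gfun S u κ '' frontier S) :=
    hm.trans_le (le_csInf ⟨_, mem_image_of_mem _ hy⟩ (forall_mem_image.2 fun x hx => (hmM x hx).1))
  have hbounds : ∀ x ∈ frontier S, sInf (Gfun S u κ '' frontier S) ≤ Gfun S u κ x ∧
      Gfun S u κ x ≤ sSup (Gfun S u κ '' frontier S) := fun x hx =>
    ⟨csInf_le hbelow (mem_image_of_mem _ hx), le_csSup habove (mem_image_of_mem _ hx)⟩
  have hsup : 0 < sSup (Gfun S u κ '' frontier S) :=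
    hinf.trans_le ((hbounds y hy).1.trans (hbounds y hy).2)
  exact exists_tendsto_zero_of_eventually fun η hη hη1 =>
    exists_floatingBody_inclusions hn hS hC2 hκ hinf hsup hbounds hη hη1
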